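/- arXiv:math/9811141 — 9 statements merged into one kernel-verified Lean document; each statement's English description precedes it below -/
import Mathlib

section
/- (Proposition 1.) There is a ℂ-algebra isomorphism φ: F_a → F_Ch determined by φ(a_1^-) = e_1, φ(a_1^+) = f_1 and, for 2 ≤ i ≤ N, φ(a_i^-) = φ(a_{i−1}^-)·e_i − e_i·φ(a_{i−1}^-) and φ(a_i^+) = f_i·φ(a_{i−1}^+) − φ(a_{i−1}^+)·f_i. (In other words, U[sl(n+1|m)], presented by Chevalley generators and the Cartan–Kac and Serre relations, is also presented by the 2N generators a_i^± subject only to the relations (18).) -/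
/-- The grading index: `θ i = 0` if `i ≤ n`, `θ i = 1` if `i > n`. -/
def thetaIdx (n i : ℕ) : ℕ := if i ≤ n then 0 else 1

/-- `p_i = θ_{i−1} + θ_i`. -/
def pIdx (n i : ℕ) : ℕ := thetaIdx n (i - 1) + thetaIdx n i

/-- The distinguished Cartan matrix of `sl(n+1|m)`:
`α_{ij} = (1+(−1)^{p_i})δ_{ij} − (−1)^{p_i}δ_{i,j−1} − δ_{i−1,j}`. -/
def alphaMat (n i j : ℕ) : ℤ :=
  (1 + (-1) ^ pIdx n i) * (if i = j then 1 else 0)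
    - (-1) ^ pIdx n i * (if i + 1 = j then 1 else 0)
    - (if i = j + 1 then 1 else 0)

/-- Generators `h_i, e_i, f_i` (`1 ≤ i ≤ N`) of the Chevalley presentation. -/
inductive ChGen (N : ℕ) : Type where
  | h : {i : ℕ // 1 ≤ i ∧ i ≤ N} → ChGen N
  | e : {i : ℕ // 1 ≤ i ∧ i ≤ N} → ChGen N
  | f : {i : ℕ // 1 ≤ i ∧ i ≤ N} → ChGen N

/-- Generators `a_i^+, a_i^-` (`1 ≤ i ≤ N`) of the CAG presentation. -/
inductive AGen (N : ℕ) : Type where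
  | plus : {i : ℕ // 1 ≤ i ∧ i ≤ N} → AGen N
  | minus : {i : ℕ // 1 ≤ i ∧ i ≤ N} → AGen N

/-- The generator `h_i` in the free algebra (junk value `0` out of range). -/
noncomputable def hG (N i : ℕ) : FreeAlgebra ℂ (ChGen N) :=
  if h : 1 ≤ i ∧ i ≤ N then FreeAlgebra.ι ℂ (ChGen.h ⟨i, h⟩) else 0

/-- The generator `e_i` in the free algebra (junk value `0` out of range). -/
noncomputable def eG (N i : ℕ) : FreeAlgebra ℂ (ChGen N) :=
  if h : 1 ≤ i ∧ i ≤ N then FreeAlgebra.ι ℂ (ChGen.e ⟨i, h⟩) else 0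

/-- The generator `f_i` in the free algebra (junk value `0` out of range). -/
noncomputable def fG (N i : ℕ) : FreeAlgebra ℂ (ChGen N) :=
  if h : 1 ≤ i ∧ i ≤ N then FreeAlgebra.ι ℂ (ChGen.f ⟨i, h⟩) else 0

/-- The generator `a_i^+` in the free algebra (junk value `0` out of range). -/
noncomputable def aPG (N i : ℕ) : FreeAlgebra ℂ (AGen N) :=
  if h : 1 ≤ i ∧ i ≤ N then FreeAlgebra.ι ℂ (AGen.plus ⟨i, h⟩) else 0

/-- The generator `a_i^-` in the free algebra (junk value `0` out of range). -/
noncomputable def aMG (N i : ℕ) : FreeAlgebra ℂ (AGen N) :=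
  if h : 1 ≤ i ∧ i ≤ N then FreeAlgebra.ι ℂ (AGen.minus ⟨i, h⟩) else 0

/-- The defining relations of `F_Ch`: the Cartan–Kac relations and the Serre
relations (including the additional Serre relations) of `U[sl(n+1|m)]`. -/
inductive chRel (n m : ℕ) :
    FreeAlgebra ℂ (ChGen (n + m)) → FreeAlgebra ℂ (ChGen (n + m)) → Prop where
  | hh (i j : ℕ) (hi : 1 ≤ i ∧ i ≤ n + m) (hj : 1 ≤ j ∧ j ≤ n + m) :
      chRel n m (hG (n + m) i * hG (n + m) j) (hG (n + m) j * hG (n + m) i)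
  | he (i j : ℕ) (hi : 1 ≤ i ∧ i ≤ n + m) (hj : 1 ≤ j ∧ j ≤ n + m) :
      chRel n m (hG (n + m) i * eG (n + m) j)
        (eG (n + m) j * hG (n + m) i + ((alphaMat n i j : ℂ)) • eG (n + m) j)
  | hf (i j : ℕ) (hi : 1 ≤ i ∧ i ≤ n + m) (hj : 1 ≤ j ∧ j ≤ n + m) :
      chRel n m (hG (n + m) i * fG (n + m) j)
        (fG (n + m) j * hG (n + m) i - ((alphaMat n i j : ℂ)) • fG (n + m) j)
  | ef (i j : ℕ) (hi : 1 ≤ i ∧ i ≤ n + m) (hj : 1 ≤ j ∧ j ≤ n + m) :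
      chRel n m
        (eG (n + m) i * fG (n + m) j
          - ((-1 : ℂ) ^ (pIdx n i * pIdx n j)) • (fG (n + m) j * eG (n + m) i))
        ((if i = j then (1 : ℂ) else 0) • hG (n + m) i)
  | ee (i j : ℕ) (hi : 1 ≤ i ∧ i ≤ n + m) (hj : 1 ≤ j ∧ j ≤ n + m)
      (hij : i ≠ j + 1 ∧ j ≠ i + 1) :
      chRel n m (eG (n + m) i * eG (n + m) j) (eG (n + m) j * eG (n + m) i)
  | ff (i j : ℕ) (hi : 1 ≤ i ∧ i ≤ n + m) (hj : 1 ≤ j ∧ j ≤ n + m)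
      (hij : i ≠ j + 1 ∧ j ≠ i + 1) :
      chRel n m (fG (n + m) i * fG (n + m) j) (fG (n + m) j * fG (n + m) i)
  | esq (h : n + 1 ≤ n + m) :
      chRel n m (eG (n + m) (n + 1) * eG (n + m) (n + 1)) 0
  | fsq (h : n + 1 ≤ n + m) :
      chRel n m (fG (n + m) (n + 1) * fG (n + m) (n + 1)) 0
  | eSerre (i j : ℕ) (hi : 1 ≤ i ∧ i ≤ n + m) (hj : 1 ≤ j ∧ j ≤ n + m)
      (hij : j = i + 1 ∨ i = j + 1) :
      chRel n m
        (eG (n + m) i *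
            (eG (n + m) i * eG (n + m) j
              - ((-1 : ℂ) ^ (pIdx n i * pIdx n j)) • (eG (n + m) j * eG (n + m) i))
          - ((-1 : ℂ) ^ (pIdx n i * (pIdx n i + pIdx n j))) •
              ((eG (n + m) i * eG (n + m) j
                - ((-1 : ℂ) ^ (pIdx n i * pIdx n j)) • (eG (n + m) j * eG (n + m) i))
                * eG (n + m) i))
        0
  | fSerre (i j : ℕ) (hi : 1 ≤ i ∧ i ≤ n + m) (hj : 1 ≤ j ∧ j ≤ n + m)
      (hij : j = i + 1 ∨ i = j + 1) :
      chRel n m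
        (fG (n + m) i *
            (fG (n + m) i * fG (n + m) j
              - ((-1 : ℂ) ^ (pIdx n i * pIdx n j)) • (fG (n + m) j * fG (n + m) i))
          - ((-1 : ℂ) ^ (pIdx n i * (pIdx n i + pIdx n j))) •
              ((fG (n + m) i * fG (n + m) j
                - ((-1 : ℂ) ^ (pIdx n i * pIdx n j)) • (fG (n + m) j * fG (n + m) i))
                * fG (n + m) i))
        0
  | eAdd (hn : 1 ≤ n) (hN : n + 2 ≤ n + m) :
      chRel n m
        ((eG (n + m) (n + 1) * eG (n + m) n - eG (n + m) n * eG (n + m) (n + 1)) *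
            (eG (n + m) (n + 1) * eG (n + m) (n + 2)
              - eG (n + m) (n + 2) * eG (n + m) (n + 1))
          + (eG (n + m) (n + 1) * eG (n + m) (n + 2)
              - eG (n + m) (n + 2) * eG (n + m) (n + 1)) *
            (eG (n + m) (n + 1) * eG (n + m) n - eG (n + m) n * eG (n + m) (n + 1)))
        0
  | fAdd (hn : 1 ≤ n) (hN : n + 2 ≤ n + m) :
      chRel n m
        ((fG (n + m) (n + 1) * fG (n + m) n - fG (n + m) n * fG (n + m) (n + 1)) *
            (fG (n + m) (n + 1) * fG (n + m) (n + 2)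
              - fG (n + m) (n + 2) * fG (n + m) (n + 1))
          + (fG (n + m) (n + 1) * fG (n + m) (n + 2)
              - fG (n + m) (n + 2) * fG (n + m) (n + 1)) *
            (fG (n + m) (n + 1) * fG (n + m) n - fG (n + m) n * fG (n + m) (n + 1)))
        0

/-- The defining relations of `F_a`: relations (18) for the creation and
annihilation generators. -/
inductive aRel (n m : ℕ) :
    FreeAlgebra ℂ (AGen (n + m)) → FreeAlgebra ℂ (AGen (n + m)) → Prop where
  | a12plus (hN : 2 ≤ n + m) :
      aRel n m
        (aPG (n + m) 1 * aPG (n + m) 2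
          - ((-1 : ℂ) ^ (thetaIdx n 1 * thetaIdx n 2)) • (aPG (n + m) 2 * aPG (n + m) 1))
        0
  | a12minus (hN : 2 ≤ n + m) :
      aRel n m
        (aMG (n + m) 1 * aMG (n + m) 2
          - ((-1 : ℂ) ^ (thetaIdx n 1 * thetaIdx n 2)) • (aMG (n + m) 2 * aMG (n + m) 1))
        0
  | a11plus :
      aRel n m
        (aPG (n + m) 1 * aPG (n + m) 1
          - ((-1 : ℂ) ^ (thetaIdx n 1 * thetaIdx n 1)) • (aPG (n + m) 1 * aPG (n + m) 1))
        0
  | a11minus :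
      aRel n m
        (aMG (n + m) 1 * aMG (n + m) 1
          - ((-1 : ℂ) ^ (thetaIdx n 1 * thetaIdx n 1)) • (aMG (n + m) 1 * aMG (n + m) 1))
        0
  | triplePlus (i j k : ℕ) (hi : 1 ≤ i ∧ i ≤ n + m) (hj : 1 ≤ j ∧ j ≤ n + m)
      (hk : 1 ≤ k ∧ k ≤ n + m) (hij : i ≤ j + 1 ∧ j ≤ i + 1) :
      aRel n m
        ((aPG (n + m) i * aMG (n + m) j
            - ((-1 : ℂ) ^ (thetaIdx n i * thetaIdx n j)) • (aMG (n + m) j * aPG (n + m) i))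
            * aPG (n + m) k
          - ((-1 : ℂ) ^ ((thetaIdx n i + thetaIdx n j) * thetaIdx n k)) •
              (aPG (n + m) k *
                (aPG (n + m) i * aMG (n + m) j
                  - ((-1 : ℂ) ^ (thetaIdx n i * thetaIdx n j)) •
                      (aMG (n + m) j * aPG (n + m) i))))
        ((if j = k then (1 : ℂ) else 0) • aPG (n + m) i
          + (((-1 : ℂ) ^ thetaIdx n i) * (if i = j then 1 else 0)) • aPG (n + m) k)
  | tripleMinus (i j k : ℕ) (hi : 1 ≤ i ∧ i ≤ n + m) (hj : 1 ≤ j ∧ j ≤ n + m)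
      (hk : 1 ≤ k ∧ k ≤ n + m) (hij : i ≤ j + 1 ∧ j ≤ i + 1) :
      aRel n m
        ((aPG (n + m) i * aMG (n + m) j
            - ((-1 : ℂ) ^ (thetaIdx n i * thetaIdx n j)) • (aMG (n + m) j * aPG (n + m) i))
            * aMG (n + m) k
          - ((-1 : ℂ) ^ ((thetaIdx n i + thetaIdx n j) * thetaIdx n k)) •
              (aMG (n + m) k *
                (aPG (n + m) i * aMG (n + m) j
                  - ((-1 : ℂ) ^ (thetaIdx n i * thetaIdx n j)) •
                      (aMG (n + m) j * aPG (n + m) i))))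
        (-((((-1 : ℂ) ^ ((thetaIdx n i + thetaIdx n j) * thetaIdx n k))
              * (if i = k then 1 else 0)) • aMG (n + m) j)
          - (((-1 : ℂ) ^ thetaIdx n i) * (if i = j then 1 else 0)) • aMG (n + m) k)

/-- The image of `e_i` in `F_Ch`. -/
noncomputable def eQ (n m i : ℕ) : RingQuot (chRel n m) :=
  RingQuot.mkAlgHom ℂ (chRel n m) (eG (n + m) i)

/-- The image of `f_i` in `F_Ch`. -/
noncomputable def fQ (n m i : ℕ) : RingQuot (chRel n m) :=
  RingQuot.mkAlgHom ℂ (chRel n m) (fG (n + m) i)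

/-- The image of `a_i^+` in `F_a`. -/
noncomputable def aPQ (n m i : ℕ) : RingQuot (aRel n m) :=
  RingQuot.mkAlgHom ℂ (aRel n m) (aPG (n + m) i)

/-- The image of `a_i^-` in `F_a`. -/
noncomputable def aMQ (n m i : ℕ) : RingQuot (aRel n m) :=
  RingQuot.mkAlgHom ℂ (aRel n m) (aMG (n + m) i)


set_option linter.unusedSimpArgs false

namespace SlPres

/-- The sign character of `ZMod 2`. -/
def chi (x : ZMod 2) : ℤ := if x = 0 then 1 else -1

/-- The grading as an element of `ZMod 2`. -/
def tt (n i : ℕ) : ZMod 2 := (thetaIdx n i : ZMod 2)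

theorem tt_le {n i : ℕ} (h : i ≤ n) : tt n i = 0 := by simp [tt, thetaIdx, h]

theorem tt_gt {n i : ℕ} (h : ¬ i ≤ n) : tt n i = 1 := by simp [tt, thetaIdx, h]

theorem chi_zero : chi 0 = 1 := rfl

theorem chi_one : chi 1 = -1 := rfl

theorem chi_add (x y : ZMod 2) : chi (x + y) = chi x * chi y := by
  revert x y; decide

theorem chi_mul_self (x : ZMod 2) : chi x * chi x = 1 := by
  revert x; decide

theorem z2_add_self (x : ZMod 2) : x + x = 0 := by
  revert x; decide

theorem z2_one_add : (1 : ZMod 2) + 1 = 0 := rfl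

theorem chi_cast (k : ℕ) : chi (k : ZMod 2) = (-1 : ℤ) ^ k := by
  induction k with
  | zero => simp [chi_zero]
  | succ k ih => rw [Nat.cast_succ, chi_add, ih, pow_succ]; rfl

theorem z2_cases (x : ZMod 2) : x = 0 ∨ x = 1 := by
  revert x; decide

section Basics

variable {R : Type*} [Ring R]

/-- The superbracket of homogeneous elements of degrees `c`, `d`. -/
def sb (c d : ZMod 2) (x y : R) : R := x * y - chi (c * d) • (y * x)

theorem sb_zero_right (c d : ZMod 2) (x : R) : sb c d x 0 = 0 := by simp [sb]

theorem sb_zero_left (c d : ZMod 2) (x : R) : sb c d 0 x = 0 := by simp [sb]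

theorem sb_jac (a b c : ZMod 2) (x y z : R) :
    sb a (b + c) x (sb b c y z)
      = sb (a + b) c (sb a b x y) z + chi (a * b) • sb b (a + c) y (sb a c x z) := by
  rcases z2_cases a with rfl | rfl <;> rcases z2_cases b with rfl | rfl <;>
    rcases z2_cases c with rfl | rfl <;>
    simp only [sb, z2_one_add, chi_zero, chi_one, zero_mul, mul_zero, one_mul, mul_one, zero_add,
      add_zero] <;> noncomm_ring

theorem sb_swap (a b : ZMod 2) (x y : R) : sb a b x y = - chi (a * b) • sb b a y x := by
  rcases z2_cases a with rfl | rfl <;> rcases z2_cases b with rfl | rfl <;>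
    simp only [sb, chi_zero, chi_one, zero_mul, mul_zero, one_mul] <;> noncomm_ring

theorem sb_smul_left (a b : ZMod 2) (k : ℤ) (x y : R) : sb a b (k • x) y = k • sb a b x y := by
  simp only [sb, smul_mul_assoc, mul_smul_comm, smul_sub, smul_comm k]

theorem sb_smul_right (a b : ZMod 2) (k : ℤ) (x y : R) : sb a b x (k • y) = k • sb a b x y := by
  simp only [sb, smul_mul_assoc, mul_smul_comm, smul_sub, smul_comm k]

theorem sb_add_left (a b : ZMod 2) (x x' y : R) :
    sb a b (x + x') y = sb a b x y + sb a b x' y := by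
  simp only [sb, add_mul, mul_add, smul_add]; abel

theorem sb_add_right (a b : ZMod 2) (x y y' : R) :
    sb a b x (y + y') = sb a b x y + sb a b x y' := by
  simp only [sb, add_mul, mul_add, smul_add]; abel

theorem sb_neg_left (a b : ZMod 2) (x y : R) : sb a b (-x) y = - sb a b x y := by
  simp only [sb, neg_mul, mul_neg, smul_neg]; abel

theorem sb_neg_right (a b : ZMod 2) (x y : R) : sb a b x (-y) = - sb a b x y := by
  simp only [sb, neg_mul, mul_neg, smul_neg]; abel

theorem sb_sub_right (a b : ZMod 2) (x y y' : R) :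
    sb a b x (y - y') = sb a b x y - sb a b x y' := by
  rw [sub_eq_add_neg, sb_add_right, sb_neg_right, ← sub_eq_add_neg]

theorem sb_sub_left (a b : ZMod 2) (x x' y : R) :
    sb a b (x - x') y = sb a b x y - sb a b x' y := by
  rw [sub_eq_add_neg, sb_add_left, sb_neg_left, ← sub_eq_add_neg]

theorem sb_even (x y : R) {c d : ZMod 2} (h : c * d = 0) : sb c d x y = x * y - y * x := by
  simp [sb, h, chi_zero]

theorem sb_odd (x y : R) {c d : ZMod 2} (h : c * d = 1) : sb c d x y = x * y + y * x := by
  simp [sb, h, chi_one]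

theorem sb_op (c d : ZMod 2) (x y : R) :
    sb c d (MulOpposite.op x) (MulOpposite.op y) = - chi (c * d) • MulOpposite.op (sb c d x y) := by
  rcases z2_cases (c * d) with h | h <;>
    simp [sb, h, chi_zero, chi_one, add_comm]

theorem sb_op' (c d : ZMod 2) (x y : R) :
    sb c d (MulOpposite.op x) (MulOpposite.op y) = MulOpposite.op (sb d c y x) := by
  simp [sb, mul_comm c d, -zsmul_eq_mul]

end Basics

/-- The Chevalley relations, for three families in a ring. -/
structure ChSys (n N : ℕ) {R : Type*} [Ring R] (h e f : ℕ → R) : Prop where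
  hh : ∀ i j, 1 ≤ i → i ≤ N → 1 ≤ j → j ≤ N → h i * h j = h j * h i
  he : ∀ i j, 1 ≤ i → i ≤ N → 1 ≤ j → j ≤ N → h i * e j = e j * h i + alphaMat n i j • e j
  hf : ∀ i j, 1 ≤ i → i ≤ N → 1 ≤ j → j ≤ N → h i * f j = f j * h i - alphaMat n i j • f j
  ef : ∀ i j, 1 ≤ i → i ≤ N → 1 ≤ j → j ≤ N →
    sb (tt n (i - 1) + tt n i) (tt n (j - 1) + tt n j) (e i) (f j) = if i = j then h i else 0
  ee : ∀ i j, 1 ≤ i → i ≤ N → 1 ≤ j → j ≤ N → i ≠ j + 1 → j ≠ i + 1 → e i * e j = e j * e i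
  ff : ∀ i j, 1 ≤ i → i ≤ N → 1 ≤ j → j ≤ N → i ≠ j + 1 → j ≠ i + 1 → f i * f j = f j * f i
  esq : e (n + 1) * e (n + 1) = 0
  fsq : f (n + 1) * f (n + 1) = 0
  eSerre : ∀ i j, 1 ≤ i → i ≤ N → 1 ≤ j → j ≤ N → (j = i + 1 ∨ i = j + 1) → i ≠ n + 1 →
    e i * e i * e j - 2 * (e i * e j * e i) + e j * e i * e i = 0
  fSerre : ∀ i j, 1 ≤ i → i ≤ N → 1 ≤ j → j ≤ N → (j = i + 1 ∨ i = j + 1) → i ≠ n + 1 →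
    f i * f i * f j - 2 * (f i * f j * f i) + f j * f i * f i = 0
  eAdd : 1 ≤ n → n + 2 ≤ N →
    (e (n + 1) * e n - e n * e (n + 1)) * (e (n + 1) * e (n + 2) - e (n + 2) * e (n + 1))
      + (e (n + 1) * e (n + 2) - e (n + 2) * e (n + 1)) * (e (n + 1) * e n - e n * e (n + 1)) = 0
  fAdd : 1 ≤ n → n + 2 ≤ N →
    (f (n + 1) * f n - f n * f (n + 1)) * (f (n + 1) * f (n + 2) - f (n + 2) * f (n + 1))
      + (f (n + 1) * f (n + 2) - f (n + 2) * f (n + 1)) * (f (n + 1) * f n - f n * f (n + 1)) = 0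

/-- The creation and annihilation relations, for two families in a ring. -/
structure ASys (n N : ℕ) {R : Type*} [Ring R] (a b : ℕ → R) : Prop where
  aa12 : 2 ≤ N → sb (tt n 1) (tt n 2) (a 1) (a 2) = 0
  bb12 : 2 ≤ N → sb (tt n 1) (tt n 2) (b 1) (b 2) = 0
  aa11 : n = 0 → a 1 * a 1 = 0
  bb11 : n = 0 → b 1 * b 1 = 0
  tp : ∀ i j k, 1 ≤ i → i ≤ N → 1 ≤ j → j ≤ N → 1 ≤ k → k ≤ N → i ≤ j + 1 → j ≤ i + 1 →
    sb (tt n i + tt n j) (tt n k) (sb (tt n i) (tt n j) (a i) (b j)) (a k)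
      = (if j = k then a i else 0) + (if i = j then chi (tt n i) • a k else 0)
  tm : ∀ i j k, 1 ≤ i → i ≤ N → 1 ≤ j → j ≤ N → 1 ≤ k → k ≤ N → i ≤ j + 1 → j ≤ i + 1 →
    sb (tt n i + tt n j) (tt n k) (sb (tt n i) (tt n j) (a i) (b j)) (b k)
      = -(if i = k then chi ((tt n i + tt n j) * tt n k) • b j else 0)
        - (if i = j then chi (tt n i) • b k else 0)

open MulOpposite in
theorem ChSys.dual {n N : ℕ} {R : Type*} [Ring R] {h e f : ℕ → R} (H : ChSys n N h e f) :
    ChSys n N (fun i => op (h i)) (fun i => op (f i)) (fun i => op (e i)) where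
  hh i j h1 h2 h3 h4 := by simpa using congrArg op (H.hh j i h3 h4 h1 h2)
  he i j h1 h2 h3 h4 := by
    have := congrArg op (H.hf i j h1 h2 h3 h4)
    simp only [op_mul, op_sub, op_smul] at this
    rw [this]; abel
  hf i j h1 h2 h3 h4 := by
    have := congrArg op (H.he i j h1 h2 h3 h4)
    simp only [op_mul, op_add, op_smul] at this
    rw [this]; abel
  ef i j h1 h2 h3 h4 := by
    rw [sb_op', H.ef j i h3 h4 h1 h2]
    by_cases hij : i = j
    · subst hij; simp
    · simp [hij, Ne.symm hij]
  ee i j h1 h2 h3 h4 h5 h6 := by simpa using congrArg op (H.ff j i h3 h4 h1 h2 h6 h5)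
  ff i j h1 h2 h3 h4 h5 h6 := by simpa using congrArg op (H.ee j i h3 h4 h1 h2 h6 h5)
  esq := by simpa using congrArg op H.fsq
  fsq := by simpa using congrArg op H.esq
  eSerre i j h1 h2 h3 h4 h5 h6 := by
    have := congrArg op (H.fSerre i j h1 h2 h3 h4 h5 h6)
    simp only [op_mul, op_add, op_sub, op_zero, op_ofNat] at this
    rw [← this]; noncomm_ring
  fSerre i j h1 h2 h3 h4 h5 h6 := by
    have := congrArg op (H.eSerre i j h1 h2 h3 h4 h5 h6)
    simp only [op_mul, op_add, op_sub, op_zero, op_ofNat] at this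
    rw [← this]; noncomm_ring
  eAdd h1 h2 := by
    have := congrArg op (H.fAdd h1 h2)
    simp only [op_mul, op_add, op_sub, op_zero] at this
    rw [← this]; noncomm_ring
  fAdd h1 h2 := by
    have := congrArg op (H.eAdd h1 h2)
    simp only [op_mul, op_add, op_sub, op_zero] at this
    rw [← this]; noncomm_ring

open MulOpposite in
theorem ASys.dual {n N : ℕ} {R : Type*} [Ring R] {a b : ℕ → R} (H : ASys n N a b) :
    ASys n N (fun i => op (b i)) (fun i => op (a i)) where
  aa12 h := by rw [sb_op, H.bb12 h]; simp
  bb12 h := by rw [sb_op, H.aa12 h]; simp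
  aa11 h := by simpa using congrArg op (H.bb11 h)
  bb11 h := by simpa using congrArg op (H.aa11 h)
  tp i j k h1 h2 h3 h4 h5 h6 h7 h8 := by
    rw [sb_op', sb_op, add_comm (tt n i), H.tm j i k h3 h4 h1 h2 h5 h6 h8 h7]
    by_cases hij : i = j
    · subst hij
      simp only [z2_add_self, zero_mul, chi_zero]
      split_ifs <;> simp [-zsmul_eq_mul] <;> try abel
    · simp only [hij, Ne.symm hij, if_false]
      split_ifs
      · simp [smul_smul, chi_mul_self, -zsmul_eq_mul]
      · simp
  tm i j k h1 h2 h3 h4 h5 h6 h7 h8 := by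
    rw [sb_op', sb_op, add_comm (tt n i), H.tp j i k h3 h4 h1 h2 h5 h6 h8 h7]
    by_cases hij : i = j
    · subst hij
      simp only [z2_add_self, zero_mul, chi_zero]
      split_ifs <;> simp [-zsmul_eq_mul] <;> try abel
    · simp only [hij, Ne.symm hij, if_false]
      split_ifs
      · simp
      · simp


section AtoCh

/-- `E_{ij} - δ_{ij} (±) E_{00}` in terms of creation and annihilation operators. -/
def EE (n : ℕ) {R : Type*} [Ring R] (a b : ℕ → R) (i j : ℕ) : R :=
  sb (tt n i) (tt n j) (a i) (b j)

/-- The Chevalley generators `e_i`. -/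
def eA (n : ℕ) {R : Type*} [Ring R] (a b : ℕ → R) : ℕ → R
  | 0 => 0
  | 1 => b 1
  | k + 2 => EE n a b (k + 1) (k + 2)

/-- The Chevalley generators `f_i`. -/
def fA (n : ℕ) {R : Type*} [Ring R] (a b : ℕ → R) : ℕ → R
  | 0 => 0
  | 1 => a 1
  | k + 2 => EE n a b (k + 2) (k + 1)

/-- The Chevalley generators `h_i`. -/
def hA (n : ℕ) {R : Type*} [Ring R] (a b : ℕ → R) : ℕ → R
  | 0 => 0
  | 1 => - chi (tt n 1) • EE n a b 1 1
  | k + 2 => EE n a b (k + 1) (k + 1)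
      - chi (tt n (k + 1) + tt n (k + 2)) • EE n a b (k + 2) (k + 2)

theorem z2_cancel (x y : ZMod 2) : x + y + y = x := by
  revert x y; decide

theorem z2_cancel' (x y : ZMod 2) : x + y + x = y := by
  revert x y; decide

theorem z2_idem (x : ZMod 2) : x * x = x := by
  revert x; decide

theorem p_mul_p {n i j : ℕ} (h : i ≠ j) :
    (tt n i + tt n (i + 1)) * (tt n j + tt n (j + 1)) = 0 := by
  simp only [tt, thetaIdx]
  split_ifs <;> first | omega | decide

theorem p_mul_t (n i : ℕ) : (tt n i + tt n (i + 1)) * tt n i = 0 := by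
  simp only [tt, thetaIdx]
  split_ifs <;> first | omega | decide

theorem p_mul_t_lt {n i k : ℕ} (h : k ≤ i) : (tt n i + tt n (i + 1)) * tt n k = 0 := by
  simp only [tt, thetaIdx]
  split_ifs <;> first | omega | decide

theorem p_even {n i : ℕ} (h : i ≠ n) : tt n i + tt n (i + 1) = 0 := by
  simp only [tt, thetaIdx]
  split_ifs <;> first | omega | decide

theorem p_odd (n : ℕ) : tt n n + tt n (n + 1) = 1 := by
  simp [tt, thetaIdx]

theorem alpha_eq (n i j : ℕ) :
    alphaMat n (i + 1) j = (1 + chi (tt n i + tt n (i + 1))) * (if i + 1 = j then 1 else 0)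
      - chi (tt n i + tt n (i + 1)) * (if i + 2 = j then 1 else 0) - (if i = j then 1 else 0) := by
  simp only [tt, ← Nat.cast_add, chi_cast, alphaMat, pIdx, Nat.add_sub_cancel]
  simp [Nat.add_right_cancel_iff]

theorem comm_comb {R : Type*} [Ring R] {K K' x : R} {w w' : ℤ} (c : ℤ)
    (h1 : K * x = x * K + w • x) (h2 : K' * x = x * K' + w' • x) :
    (K - c • K') * x = x * (K - c • K') + (w - c * w') • x := by
  rw [sub_mul, smul_mul_assoc, h1, h2, mul_sub, mul_smul_comm, smul_add, sub_smul, mul_smul]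
  abel

theorem comm_smul {R : Type*} [Ring R] {K x : R} {w : ℤ} (c : ℤ)
    (h1 : K * x = x * K + w • x) :
    (c • K) * x = x * (c • K) + (c * w) • x := by
  rw [smul_mul_assoc, h1, mul_smul_comm, smul_add, mul_smul]

theorem serre_of {R : Type*} [Ring R] {x y w : R} (h1 : x * y - y * x = w)
    (h2 : x * w - w * x = 0) : x * x * y - 2 * (x * y * x) + y * x * x = 0 := by
  rw [← h2, ← h1]; noncomm_ring

theorem add_of {R : Type*} [Ring R] {y z w u q : R} (h1 : y * w - w * y = -u)
    (h2 : z * u - u * z = -q) (h3 : y * u + u * y = 0) (h4 : y * q + q * y = 0) :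
    (y * w - w * y) * (y * z - z * y) + (y * z - z * y) * (y * w - w * y) = 0 := by
  have hq : q = u * z - z * u := by rw [← neg_inj, ← h2]; abel
  have hyu : y * u = - (u * y) := eq_neg_of_add_eq_zero_left h3
  rw [h1]
  rw [hq] at h4
  have : -u * (y * z - z * y) + (y * z - z * y) * -u
      = (y * (u * z - z * u) + (u * z - z * u) * y) - (y * u + u * y) * z + z * (y * u + u * y) := by
    noncomm_ring
  rw [this, h3, h4]; simp

variable {n N : ℕ} {R : Type*} [Ring R] {a b : ℕ → R}

theorem ASys.M (H : ASys n N a b) (k l i j : ℕ) (hk : 1 ≤ k) (hk' : k ≤ N) (hl : 1 ≤ l)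
    (hl' : l ≤ N) (hi : 1 ≤ i) (hi' : i ≤ N) (hj : 1 ≤ j) (hj' : j ≤ N) (hkl : k ≤ l + 1)
    (hlk : l ≤ k + 1) :
    sb (tt n k + tt n l) (tt n i + tt n j) (EE n a b k l) (EE n a b i j)
      = (if l = i then EE n a b k j else 0)
        - (if k = j then chi ((tt n k + tt n l) * (tt n i + tt n j)) • EE n a b i l else 0) := by
  have h1 := H.tp k l i hk hk' hl hl' hi hi' hkl hlk
  have h2 := H.tm k l j hk hk' hl hl' hj hj' hkl hlk
  have h3 := sb_jac (tt n k + tt n l) (tt n i) (tt n j) (EE n a b k l) (a i) (b j)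
  unfold EE at h3 ⊢
  rw [h3, h1, h2]
  by_cases hc : k = l
  · subst hc
    simp only [z2_add_self, zero_mul, chi_zero, one_smul, zero_add]
    by_cases c1 : k = i <;> by_cases c2 : k = j <;> [subst c1 c2; subst c1; subst c2; skip] <;>
      simp only [*, if_true, if_false, sb_add_left, sb_smul_left, sb_smul_right, sb_sub_right,
        sb_neg_right, sb_zero_left, sb_zero_right] <;> abel
  · simp only [hc, if_false, add_zero, sub_zero]
    by_cases c1 : l = i <;> by_cases c2 : k = j <;> [subst c1 c2; subst c1; subst c2; skip] <;>
      simp only [*, if_true, if_false, sb_add_left, sb_smul_left, sb_smul_right, sb_sub_right,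
        sb_neg_right, sb_zero_left, sb_zero_right, z2_cancel, z2_cancel', mul_add, chi_add,
        mul_smul, smul_neg, neg_zero, smul_zero] <;> abel

theorem ASys.Kb (H : ASys n N a b) (i k : ℕ) (hi : 1 ≤ i) (hi' : i ≤ N) (hk : 1 ≤ k)
    (hk' : k ≤ N) :
    EE n a b i i * b k = b k * EE n a b i i
      + (-(if i = k then 1 else 0) - chi (tt n i)) • b k := by
  have h := H.tm i i k hi hi' hi hi' hk hk' (by omega) (by omega)
  rw [sb_even _ _ (by rw [z2_add_self, zero_mul])] at h
  rw [← sub_eq_iff_eq_add', EE, h]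
  simp only [z2_add_self, zero_mul, chi_zero, one_smul, if_true, sub_smul, neg_smul]
  by_cases c : i = k
  · subst c; simp
  · simp [c]

theorem ASys.KE (H : ASys n N a b) (i k l : ℕ) (hi : 1 ≤ i) (hi' : i ≤ N) (hk : 1 ≤ k)
    (hk' : k ≤ N) (hl : 1 ≤ l) (hl' : l ≤ N) :
    EE n a b i i * EE n a b k l = EE n a b k l * EE n a b i i
      + ((if i = k then 1 else 0 : ℤ) - (if i = l then 1 else 0)) • EE n a b k l := by
  have h := H.M i i k l hi hi' hi hi' hk hk' hl hl' (by omega) (by omega)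
  rw [sb_even _ _ (by rw [z2_add_self, zero_mul])] at h
  rw [← sub_eq_iff_eq_add', h]
  simp only [z2_add_self, zero_mul, chi_zero, one_smul, sub_smul]
  by_cases c : i = k <;> by_cases c' : i = l <;> [subst c c'; subst c; subst c'; skip] <;> simp [*]

theorem ASys.hh (H : ASys n N a b) (i j : ℕ) (hi : 1 ≤ i) (hi' : i ≤ N) (hj : 1 ≤ j)
    (hj' : j ≤ N) : hA n a b i * hA n a b j = hA n a b j * hA n a b i := by
  have key : ∀ i j, 1 ≤ i → i ≤ N → 1 ≤ j → j ≤ N → Commute (EE n a b i i) (EE n a b j j) := by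
    intro i j hi hi' hj hj'
    have := H.KE i j j hi hi' hj hj' hj hj'
    simpa [Commute, SemiconjBy] using this
  have e1 : ∀ i, 1 ≤ i → i ≤ N → ∀ j, 1 ≤ j → j ≤ N → Commute (hA n a b i) (EE n a b j j) := by
    intro i hi hi' j hj hj'
    match i, hi, hi' with
    | 1, _, _ => exact (key _ _ (by omega) (by omega) hj hj').smul_left _
    | k + 2, _, _ =>
      exact (key _ _ (by omega) (by omega) hj hj').sub_left
        ((key _ _ (by omega) (by omega) hj hj').smul_left _)
  match j, hj, hj' with
  | 1, _, _ => exact (e1 _ (by omega) (by omega) 1 (by omega) (by omega)).smul_right _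
  | k + 2, _, _ =>
    exact (e1 _ hi hi' _ (by omega) (by omega)).sub_right
        ((e1 _ hi hi' _ (by omega) (by omega)).smul_right _)

theorem ASys.he (H : ASys n N a b) (i j : ℕ) (hi : 1 ≤ i) (hi' : i ≤ N) (hj : 1 ≤ j)
    (hj' : j ≤ N) :
    hA n a b i * eA n a b j = eA n a b j * hA n a b i + alphaMat n i j • eA n a b j := by
  match i, hi, hi', j, hj, hj' with
  | 1, _, _, 1, _, _ =>
    have := comm_smul (-chi (tt n 1)) (H.Kb 1 1 (by omega) (by omega) (by omega) (by omega))
    simp only [hA, eA]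
    rw [this, alpha_eq]
    congr 2
    have h0 : tt n 0 = 0 := tt_le (by omega)
    rcases z2_cases (tt n 1) with h | h <;> simp [h, h0, chi_zero, chi_one]
  | 1, _, _, l + 2, _, _ =>
    have := comm_smul (-chi (tt n 1)) (H.KE 1 (l + 1) (l + 2) (by omega) (by omega) (by omega)
      (by omega) (by omega) (by omega))
    simp only [hA, eA]
    rw [this, alpha_eq]
    congr 2
    have h0 : tt n 0 = 0 := tt_le (by omega)
    rcases z2_cases (tt n 1) with h | h <;> simp [h, h0, chi_zero, chi_one] <;> omega
  | k + 2, _, _, 1, _, _ =>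
    have := comm_comb (chi (tt n (k + 1) + tt n (k + 2)))
      (H.Kb (k + 1) 1 (by omega) (by omega) (by omega) (by omega))
      (H.Kb (k + 2) 1 (by omega) (by omega) (by omega) (by omega))
    simp only [hA, eA]
    rw [this, alpha_eq]
    congr 2
    rcases z2_cases (tt n (k + 1)) with h | h <;> rcases z2_cases (tt n (k + 1 + 1)) with h' | h' <;>
      simp [h, h', chi_zero, chi_one, z2_one_add]
  | k + 2, _, _, l + 2, _, _ =>
    have := comm_comb (chi (tt n (k + 1) + tt n (k + 2)))
      (H.KE (k + 1) (l + 1) (l + 2) (by omega) (by omega) (by omega) (by omega) (by omega)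
        (by omega))
      (H.KE (k + 2) (l + 1) (l + 2) (by omega) (by omega) (by omega) (by omega) (by omega)
        (by omega))
    simp only [hA, eA]
    rw [this, alpha_eq]
    congr 2
    generalize chi (tt n (k + 1) + tt n (k + 1 + 1)) = c
    split_ifs <;> omega

theorem ASys.ee (H : ASys n N a b) (i j : ℕ) (hi : 1 ≤ i) (hi' : i ≤ N) (hj : 1 ≤ j)
    (hj' : j ≤ N) (h1 : i ≠ j + 1) (h2 : j ≠ i + 1) :
    eA n a b i * eA n a b j = eA n a b j * eA n a b i := by
  have key : ∀ l, 1 ≤ l → l + 2 ≤ N → eA n a b (l + 2) * eA n a b 1 = eA n a b 1 * eA n a b (l + 2) := by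
    intro l hl hl'
    have h := H.tm (l + 1) (l + 2) 1 (by omega) (by omega) (by omega) (by omega) (by omega)
      (by omega) (by omega) (by omega)
    rw [sb_even _ _ (p_mul_t_lt (by omega))] at h
    simp only [eA, EE]
    rw [← sub_eq_zero, h]
    simp; omega
  match i, hi, hi', j, hj, hj' with
  | 1, _, _, 1, _, _ => rfl
  | 1, _, _, l + 2, _, _ => exact (key l (by omega) (by omega)).symm
  | k + 2, _, _, 1, _, _ => exact key k (by omega) (by omega)
  | k + 2, _, _, l + 2, _, _ =>
    by_cases hkl : k = l
    · subst hkl; rfl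
    have h := H.M (k + 1) (k + 2) (l + 1) (l + 2) (by omega) (by omega) (by omega) (by omega)
      (by omega) (by omega) (by omega) (by omega) (by omega) (by omega)
    rw [sb_even _ _ (p_mul_p (by omega))] at h
    simp only [eA]
    rw [← sub_eq_zero, h, if_neg (by omega), if_neg (by omega), sub_zero]

theorem ASys.esq [Algebra ℂ R] (H : ASys n N a b) (hN : n + 1 ≤ N) :
    eA n a b (n + 1) * eA n a b (n + 1) = 0 := by
  rcases n with _ | k
  · exact H.bb11 rfl
  · have h := H.M (k + 1) (k + 2) (k + 1) (k + 2) (by omega) (by omega) (by omega) (by omega)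
      (by omega) (by omega) (by omega) (by omega) (by omega) (by omega)
    rw [sb_odd _ _ (by rw [p_odd]; rfl), if_neg (by omega), if_neg (by omega), sub_zero,
      ← two_smul ℂ] at h
    simpa [eA] using h

theorem ASys.eSerre (H : ASys n N a b) (i j : ℕ) (hi : 1 ≤ i) (hi' : i ≤ N) (hj : 1 ≤ j)
    (hj' : j ≤ N) (hij : j = i + 1 ∨ i = j + 1) (hin : i ≠ n + 1) :
    eA n a b i * eA n a b i * eA n a b j - 2 * (eA n a b i * eA n a b j * eA n a b i)
      + eA n a b j * eA n a b i * eA n a b i = 0 := by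
  have e0 : ∀ x y : ZMod 2, x = 0 → x * y = 0 := by rintro _ y rfl; exact zero_mul y
  rcases hij with rfl | rfl
  · match i, hi, hi', hj, hj' with
    | 1, _, _, _, _ =>
      have t1 : tt n 1 = 0 := tt_le (by omega)
      have h1 := H.tm 1 2 1 (by omega) (by omega) (by omega) (by omega) (by omega) (by omega)
        (by omega) (by omega)
      rw [sb_even _ _ (p_mul_t n 1), p_mul_t n 1] at h1
      have h2 := H.bb12 (by omega)
      rw [sb_even _ _ (e0 _ _ t1)] at h2
      refine serre_of (w := b 2) ?_ h2
      simp only [eA, EE]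
      rw [← neg_inj, neg_sub, h1]
      simp [chi_zero]
    | k + 2, _, _, _, _ =>
      have h1 := H.M (k + 1) (k + 2) (k + 2) (k + 3) (by omega) (by omega) (by omega) (by omega)
        (by omega) (by omega) (by omega) (by omega) (by omega) (by omega)
      have h2 := H.M (k + 1) (k + 2) (k + 1) (k + 3) (by omega) (by omega) (by omega) (by omega)
        (by omega) (by omega) (by omega) (by omega) (by omega) (by omega)
      rw [sb_even _ _ (e0 _ _ (p_even (by omega)))] at h1 h2
      rw [if_pos rfl, if_neg (by omega), sub_zero] at h1
      rw [if_neg (by omega), if_neg (by omega), sub_zero] at h2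
      exact serre_of h1 h2
  · match j, hi, hi', hj, hj' with
    | 1, _, _, _, _ =>
      have h1 := H.tm 1 2 1 (by omega) (by omega) (by omega) (by omega) (by omega) (by omega)
        (by omega) (by omega)
      have h2 := H.tm 1 2 2 (by omega) (by omega) (by omega) (by omega) (by omega) (by omega)
        (by omega) (by omega)
      rw [sb_even _ _ (e0 _ _ (p_even (by omega)))] at h1 h2
      rw [p_mul_t n 1] at h1
      simp [chi_zero] at h1 h2
      refine serre_of (w := - b 2) h1 ?_
      simp only [eA, EE, mul_neg, neg_mul, ← neg_sub', h2, neg_zero]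
    | k + 2, _, _, _, _ =>
      have h1 := H.M (k + 2) (k + 3) (k + 1) (k + 2) (by omega) (by omega) (by omega) (by omega)
        (by omega) (by omega) (by omega) (by omega) (by omega) (by omega)
      have h2 := H.M (k + 2) (k + 3) (k + 1) (k + 3) (by omega) (by omega) (by omega) (by omega)
        (by omega) (by omega) (by omega) (by omega) (by omega) (by omega)
      rw [sb_even _ _ (e0 _ _ (p_even (by omega)))] at h1 h2
      rw [if_pos rfl, if_neg (by omega), e0 _ _ (p_even (by omega)), chi_zero, one_smul,
        zero_sub] at h1
      rw [if_neg (by omega), if_neg (by omega), sub_zero] at h2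
      refine serre_of h1 ?_
      simp only [eA, mul_neg, neg_mul, ← neg_sub', h2, neg_zero]

theorem ASys.eAdd (H : ASys n N a b) (hn : 1 ≤ n) (hN : n + 2 ≤ N) :
    (eA n a b (n + 1) * eA n a b n - eA n a b n * eA n a b (n + 1)) *
        (eA n a b (n + 1) * eA n a b (n + 2) - eA n a b (n + 2) * eA n a b (n + 1))
      + (eA n a b (n + 1) * eA n a b (n + 2) - eA n a b (n + 2) * eA n a b (n + 1)) *
        (eA n a b (n + 1) * eA n a b n - eA n a b n * eA n a b (n + 1)) = 0 := by
  have e0 : ∀ x y : ZMod 2, x = 0 → x * y = 0 := by rintro _ y rfl; exact zero_mul y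
  match n, hn, hN, H with
  | 1, _, hN, H =>
    have h1 := H.tm 1 2 1 (by omega) (by omega) (by omega) (by omega) (by omega) (by omega)
        (by omega) (by omega)
    have h2 := H.tm 2 3 2 (by omega) (by omega) (by omega) (by omega) (by omega) (by omega)
        (by omega) (by omega)
    have h3 := H.tm 1 2 2 (by omega) (by omega) (by omega) (by omega) (by omega) (by omega)
        (by omega) (by omega)
    have h4 := H.tm 1 2 3 (by omega) (by omega) (by omega) (by omega) (by omega) (by omega)
        (by omega) (by omega)
    rw [sb_even _ _ (p_mul_t 1 1), p_mul_t] at h1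
    rw [sb_even _ _ (p_mul_t 1 2), p_mul_t] at h2
    rw [sb_odd _ _ (by rfl)] at h3 h4
    simp [chi_zero] at h1 h2 h3 h4
    exact add_of h1 h2 h3 h4
  | k + 2, _, hN, H =>
    have h1 := H.M (k + 2) (k + 3) (k + 1) (k + 2) (by omega) (by omega) (by omega) (by omega)
      (by omega) (by omega) (by omega) (by omega) (by omega) (by omega)
    have h2 := H.M (k + 3) (k + 4) (k + 1) (k + 3) (by omega) (by omega) (by omega) (by omega)
      (by omega) (by omega) (by omega) (by omega) (by omega) (by omega)
    have h3 := H.M (k + 2) (k + 3) (k + 1) (k + 3) (by omega) (by omega) (by omega) (by omega)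
      (by omega) (by omega) (by omega) (by omega) (by omega) (by omega)
    have h4 := H.M (k + 2) (k + 3) (k + 1) (k + 4) (by omega) (by omega) (by omega) (by omega)
      (by omega) (by omega) (by omega) (by omega) (by omega) (by omega)
    rw [sb_even _ _ (p_mul_p (by omega)), p_mul_p (by omega)] at h1
    rw [sb_even _ _ (e0 _ _ (p_even (by omega))), e0 _ _ (p_even (by omega))] at h2
    have o1 : tt (k + 2) (k + 1) = 0 := tt_le (by omega)
    have o2 : tt (k + 2) (k + 2) = 0 := tt_le (by omega)
    have o3 : tt (k + 2) (k + 3) = 1 := tt_gt (by omega)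
    have o4 : tt (k + 2) (k + 4) = 1 := tt_gt (by omega)
    rw [sb_odd _ _ (by rw [o1, o2, o3]; rfl)] at h3
    rw [sb_odd _ _ (by rw [o1, o2, o3, o4]; rfl)] at h4
    simp [chi_zero] at h1 h2 h3 h4
    exact add_of h1 h2 h3 h4

theorem ASys.ef (H : ASys n N a b) (i j : ℕ) (hi : 1 ≤ i) (hi' : i ≤ N) (hj : 1 ≤ j)
    (hj' : j ≤ N) :
    sb (tt n (i - 1) + tt n i) (tt n (j - 1) + tt n j) (eA n a b i) (fA n a b j)
      = if i = j then hA n a b i else 0 := by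
  have h0 : tt n 0 = 0 := tt_le (by omega)
  match i, hi, hi', j, hj, hj' with
  | 1, _, _, 1, _, _ =>
    simp only [Nat.sub_self, h0, zero_add, eA, fA, hA, if_true, EE]
    rw [sb_swap, z2_idem]
  | 1, _, _, l + 2, _, _ =>
    have h := H.tm (l + 2) (l + 1) 1 (by omega) (by omega) (by omega) (by omega) (by omega)
      (by omega) (by omega) (by omega)
    simp only [Nat.sub_self, h0, zero_add, eA, fA, EE]
    rw [show l + 2 - 1 = l + 1 from rfl, sb_swap, add_comm (tt n (l + 1)), h]
    simp
  | k + 2, _, _, 1, _, _ =>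
    have h := H.tp (k + 1) (k + 2) 1 (by omega) (by omega) (by omega) (by omega) (by omega)
      (by omega) (by omega) (by omega)
    simp only [Nat.sub_self, h0, zero_add, eA, fA, EE]
    rw [show k + 2 - 1 = k + 1 from rfl, h]
    simp
  | k + 2, _, _, l + 2, _, _ =>
    have h := H.M (k + 1) (k + 2) (l + 2) (l + 1) (by omega) (by omega) (by omega) (by omega)
      (by omega) (by omega) (by omega) (by omega) (by omega) (by omega)
    simp only [eA, fA, hA]
    rw [show k + 2 - 1 = k + 1 from rfl, show l + 2 - 1 = l + 1 from rfl,
      add_comm (tt n (l + 1)), h]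
    by_cases hkl : k = l
    · subst hkl
      simp only [if_true]
      rw [add_comm (tt n (k + 2)), z2_idem]
    · simp [hkl]

open MulOpposite in
theorem eA_op (i : ℕ) : eA n (fun i => op (b i)) (fun i => op (a i)) i = op (fA n a b i) := by
  match i with
  | 0 => simp [eA, fA]
  | 1 => rfl
  | k + 2 => simp only [eA, fA, EE, sb_op']

open MulOpposite in
theorem hA_op (i : ℕ) : hA n (fun i => op (b i)) (fun i => op (a i)) i = op (hA n a b i) := by
  match i with
  | 0 => simp [hA]
  | 1 => simp only [hA, EE, sb_op', op_smul]
  | k + 2 => simp only [hA, EE, sb_op', op_smul, op_sub]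

open MulOpposite in
theorem ASys.toCh [Algebra ℂ R] (H : ASys n N a b) (hN : n + 1 ≤ N) :
    ChSys n N (hA n a b) (eA n a b) (fA n a b) where
  hh := H.hh
  he := H.he
  hf i j h1 h2 h3 h4 := by
    have := congrArg unop (H.dual.he i j h1 h2 h3 h4)
    simp only [eA_op, hA_op, unop_mul, unop_add, unop_op, unop_smul] at this
    rw [this]; abel
  ef := H.ef
  ee := H.ee
  ff i j h1 h2 h3 h4 h5 h6 := by
    have := congrArg unop (H.dual.ee j i h3 h4 h1 h2 h6 h5)
    simpa only [eA_op, unop_mul, unop_op] using this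
  esq := H.esq hN
  fsq := by
    have := congrArg unop (H.dual.esq hN)
    simpa only [eA_op, unop_mul, unop_op, unop_zero] using this
  eSerre := H.eSerre
  fSerre i j h1 h2 h3 h4 h5 h6 := by
    have := congrArg unop (H.dual.eSerre i j h1 h2 h3 h4 h5 h6)
    simp only [eA_op, unop_mul, unop_op, unop_add, unop_sub, unop_zero, unop_ofNat] at this
    rw [← this]; noncomm_ring
  eAdd := H.eAdd
  fAdd h1 h2 := by
    have := congrArg unop (H.dual.eAdd h1 h2)
    simp only [eA_op, unop_mul, unop_op, unop_add, unop_sub, unop_zero] at this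
    rw [← this]; noncomm_ring

end AtoCh


section ChtoA

/-- The annihilation operators built from the `e_i`. -/
def bC {R : Type*} [Ring R] (e : ℕ → R) : ℕ → R
  | 0 => 0
  | 1 => e 1
  | k + 2 => bC e (k + 1) * e (k + 2) - e (k + 2) * bC e (k + 1)

/-- The creation operators built from the `f_i`. -/
def aC {R : Type*} [Ring R] (f : ℕ → R) : ℕ → R
  | 0 => 0
  | 1 => f 1
  | k + 2 => f (k + 2) * aC f (k + 1) - aC f (k + 1) * f (k + 2)

/-- The elements `⟦a_i^+, a_i^-⟧` as combinations of the `h_i`. -/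
def hC (n : ℕ) {R : Type*} [Ring R] (h : ℕ → R) : ℕ → R
  | 0 => 0
  | 1 => (-chi (tt n 1)) • h 1
  | k + 2 => chi (tt n (k + 1) + tt n (k + 2)) • (hC n h (k + 1) - h (k + 2))

theorem serre_lift {R : Type*} [Ring R] {x y w : R} (hxy : y * x = x * y)
    (hs : y * y * w - 2 * (y * w * y) + w * y * y = 0) :
    y * y * (x * w - w * x) - 2 * (y * (x * w - w * x) * y) + (x * w - w * x) * y * y = 0 := by
  have hxy' : ∀ t, y * (x * t) = x * (y * t) := fun t => by rw [← mul_assoc, hxy, mul_assoc]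
  have : y * y * (x * w - w * x) - 2 * (y * (x * w - w * x) * y) + (x * w - w * x) * y * y
      = x * (y * y * w - 2 * (y * w * y) + w * y * y)
        - (y * y * w - 2 * (y * w * y) + w * y * y) * x := by
    simp only [two_mul, mul_sub, sub_mul, mul_add, add_mul, mul_assoc, hxy, hxy']
    abel
  rw [this, hs]; simp

theorem serre_three {R : Type*} [Ring R] [Algebra ℂ R] {x y z : R} (hxz : z * x = x * z)
    (h1 : y * y * x - 2 * (y * x * y) + x * y * y = 0)
    (h2 : y * y * z - 2 * (y * z * y) + z * y * y = 0) :
    y * ((x * y - y * x) * z - z * (x * y - y * x))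
      - ((x * y - y * x) * z - z * (x * y - y * x)) * y = 0 := by
  have hxz' : ∀ t, z * (x * t) = x * (z * t) := fun t => by rw [← mul_assoc, hxz, mul_assoc]
  set g := y * ((x * y - y * x) * z - z * (x * y - y * x))
      - ((x * y - y * x) * z - z * (x * y - y * x)) * y with hg
  have : g + g = z * (y * y * x - 2 * (y * x * y) + x * y * y)
        - (y * y * x - 2 * (y * x * y) + x * y * y) * z
      + x * (y * y * z - 2 * (y * z * y) + z * y * y)
      - (y * y * z - 2 * (y * z * y) + z * y * y) * x := by
    rw [hg]
    simp only [two_mul, mul_sub, sub_mul, mul_add, add_mul, mul_assoc, hxz, hxz']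
    abel
  rw [h1, h2, ← two_smul ℂ] at this
  simpa using this

theorem add_lift {R : Type*} [Ring R] {x y w z : R} (hxy : y * x = x * y) (hxz : z * x = x * z)
    (hs : (y * w - w * y) * (y * z - z * y) + (y * z - z * y) * (y * w - w * y) = 0) :
    (y * (x * w - w * x) - (x * w - w * x) * y) * (y * z - z * y)
      + (y * z - z * y) * (y * (x * w - w * x) - (x * w - w * x) * y) = 0 := by
  have hxy' : ∀ t, y * (x * t) = x * (y * t) := fun t => by rw [← mul_assoc, hxy, mul_assoc]
  have hxz' : ∀ t, z * (x * t) = x * (z * t) := fun t => by rw [← mul_assoc, hxz, mul_assoc]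
  have : (y * (x * w - w * x) - (x * w - w * x) * y) * (y * z - z * y)
      + (y * z - z * y) * (y * (x * w - w * x) - (x * w - w * x) * y)
      = x * ((y * w - w * y) * (y * z - z * y) + (y * z - z * y) * (y * w - w * y))
        - ((y * w - w * y) * (y * z - z * y) + (y * z - z * y) * (y * w - w * y)) * x := by
    simp only [mul_sub, sub_mul, mul_add, add_mul, mul_assoc, hxy, hxy', hxz, hxz']
    abel
  rw [this, hs]; simp

theorem add_three {R : Type*} [Ring R] {x y z : R} (hxz : z * x = x * z) (hy : y * y = 0)
    (h : (y * x - x * y) * (y * z - z * y) + (y * z - z * y) * (y * x - x * y) = 0) :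
    y * ((x * y - y * x) * z - z * (x * y - y * x))
      + ((x * y - y * x) * z - z * (x * y - y * x)) * y = 0 := by
  have hy' : ∀ t, y * (y * t) = 0 := fun t => by rw [← mul_assoc, hy, zero_mul]
  have hxz' : ∀ t, z * (x * t) = x * (z * t) := fun t => by rw [← mul_assoc, hxz, mul_assoc]
  rw [← h]
  simp only [mul_sub, sub_mul, mul_assoc, hxz, hxz', hy, hy', mul_zero]
  abel

theorem sb_comm_right {R : Type*} [Ring R] (c d : ZMod 2) {x y z : R} (h : x * z = z * x) :
    sb c d x (y * z - z * y) = sb c d x y * z - z * sb c d x y := by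
  have h' : ∀ t, x * (z * t) = z * (x * t) := fun t => by rw [← mul_assoc, h, mul_assoc]
  simp only [sb, mul_sub, sub_mul, smul_sub, smul_mul_assoc, mul_smul_comm, mul_assoc, h, h']
  abel

theorem fb_aux {R : Type*} [Ring R] {B y z : R} {c : ℤ} (hc : c * c = 1) (hy : y * B = B * y) :
    y * (B * z - z * B) - c • ((B * z - z * B) * y)
      = c • ((z * y - c • (y * z)) * B - B * (z * y - c • (y * z))) := by
  have hy' : ∀ t, y * (B * t) = B * (y * t) := fun t => by rw [← mul_assoc, hy, mul_assoc]
  simp only [mul_sub, sub_mul, smul_sub, smul_mul_assoc, mul_smul_comm, smul_smul, hc, one_smul,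
    mul_assoc, hy, hy']
  abel

theorem comm_br {R : Type*} [Ring R] {K x y : R} {w w' : ℤ}
    (h1 : K * x = x * K + w • x) (h2 : K * y = y * K + w' • y) :
    K * (x * y - y * x) = (x * y - y * x) * K + (w + w') • (x * y - y * x) := by
  have e1 : K * (x * y) = x * (y * K) + (w + w') • (x * y) := by
    rw [← mul_assoc, h1, add_mul, mul_assoc, h2, mul_add, add_smul, smul_mul_assoc, mul_smul_comm]
    abel
  have e2 : K * (y * x) = y * (x * K) + (w + w') • (y * x) := by
    rw [← mul_assoc, h2, add_mul, mul_assoc, h1, mul_add, add_smul, smul_mul_assoc, mul_smul_comm]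
    abel
  rw [mul_sub, e1, e2, sub_mul, smul_sub, mul_assoc, mul_assoc]
  abel

variable {n N : ℕ} {R : Type*} [Ring R] {h e f : ℕ → R}

open MulOpposite in
theorem bC_op (k : ℕ) : bC (fun i => op (f i)) k = op (aC f k) := by
  induction k using Nat.strong_induction_on with
  | _ k ih =>
    match k with
    | 0 => simp [bC, aC]
    | 1 => rfl
    | k + 2 => simp only [bC, aC, ih (k + 1) (by omega), op_sub, op_mul]

open MulOpposite in
theorem aC_op (k : ℕ) : aC (fun i => op (e i)) k = op (bC e k) := by
  induction k using Nat.strong_induction_on with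
  | _ k ih =>
    match k with
    | 0 => simp [bC, aC]
    | 1 => rfl
    | k + 2 => simp only [bC, aC, ih (k + 1) (by omega), op_sub, op_mul]

open MulOpposite in
theorem hC_op (k : ℕ) : hC n (fun i => op (h i)) k = op (hC n h k) := by
  induction k using Nat.strong_induction_on with
  | _ k ih =>
    match k with
    | 0 => simp [hC]
    | 1 => simp only [hC, op_smul]
    | k + 2 => simp only [hC, ih (k + 1) (by omega), op_sub, op_smul]

theorem ChSys.eb_far (H : ChSys n N h e f) (k i : ℕ) (hki : k + 2 ≤ i) (hi : i ≤ N) :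
    e i * bC e k = bC e k * e i := by
  induction k using Nat.strong_induction_on with
  | _ k ih =>
    match k, hki, ih with
    | 0, _, _ => simp [bC]
    | 1, _, _ => exact H.ee i 1 (by omega) hi (by omega) (by omega) (by omega) (by omega)
    | k + 2, _, ih =>
      have c1 : Commute (e i) (bC e (k + 1)) := ih (k + 1) (by omega) (by omega)
      have c2 : Commute (e i) (e (k + 2)) :=
        H.ee i (k + 2) (by omega) hi (by omega) (by omega) (by omega) (by omega)
      exact (c1.mul_right c2).sub_right (c2.mul_right c1)

theorem ChSys.serre_b (H : ChSys n N h e f) (l : ℕ) (hl : l + 2 ≤ N) (hn : l + 2 ≠ n + 1) :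
    e (l + 2) * e (l + 2) * bC e (l + 1) - 2 * (e (l + 2) * bC e (l + 1) * e (l + 2))
      + bC e (l + 1) * e (l + 2) * e (l + 2) = 0 := by
  match l, hl, hn with
  | 0, hl, hn => exact H.eSerre 2 1 (by omega) hl (by omega) (by omega) (by omega) hn
  | l + 1, hl, hn =>
    exact serre_lift (H.eb_far (l + 1) (l + 3) (by omega) hl)
      (H.eSerre (l + 3) (l + 2) (by omega) hl (by omega) (by omega) (by omega) hn)

theorem ChSys.add_b (H : ChSys n N h e f) (l : ℕ) (hl : l + 3 ≤ N) (hn : l + 1 = n) :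
    (e (l + 2) * bC e (l + 1) - bC e (l + 1) * e (l + 2))
        * (e (l + 2) * e (l + 3) - e (l + 3) * e (l + 2))
      + (e (l + 2) * e (l + 3) - e (l + 3) * e (l + 2))
        * (e (l + 2) * bC e (l + 1) - bC e (l + 1) * e (l + 2)) = 0 := by
  subst hn
  match l, hl, H with
  | 0, hl, H => exact H.eAdd (by omega) hl
  | l + 1, hl, H =>
    exact add_lift (H.eb_far (l + 1) (l + 3) (by omega) (by omega))
      (H.eb_far (l + 1) (l + 4) (by omega) (by omega)) (H.eAdd (by omega) hl)

theorem ChSys.eb_ge [Algebra ℂ R] (H : ChSys n N h e f) (l d : ℕ) (hl : l + 2 + d ≤ N) :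
    sb (tt n (l + 1) + tt n (l + 2)) (tt n (l + 2 + d)) (e (l + 2)) (bC e (l + 2 + d)) = 0 := by
  have e0 : ∀ x y : ZMod 2, x = 0 → x * y = 0 := by rintro _ y rfl; exact zero_mul y
  match d with
  | 0 =>
    by_cases hn : l + 1 = n
    · subst hn
      rw [sb_odd _ _ (by rw [p_odd, tt_gt (by omega)]; rfl)]
      have hs := H.esq
      simp only [bC, add_zero]
      have : e (l + 2) * (bC e (l + 1) * e (l + 2) - e (l + 2) * bC e (l + 1))
          + (bC e (l + 1) * e (l + 2) - e (l + 2) * bC e (l + 1)) * e (l + 2)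
        = bC e (l + 1) * (e (l + 2) * e (l + 2)) - (e (l + 2) * e (l + 2)) * bC e (l + 1) := by
        noncomm_ring
      rw [this, hs]; simp
    · rw [sb_even _ _ (e0 _ _ (p_even hn))]
      have hs := H.serre_b l (by omega) (by omega)
      simp only [bC, add_zero]
      rw [← neg_inj, neg_zero, ← hs]
      noncomm_ring
  | 1 =>
    have hf := H.eb_far (l + 1) (l + 3) (by omega) (by omega)
    by_cases hn : l + 1 = n
    · have ha := H.add_b l (by omega) hn
      subst hn
      rw [sb_odd _ _ (by rw [p_odd, tt_gt (by omega)]; rfl)]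
      exact add_three hf H.esq ha
    · rw [sb_even _ _ (e0 _ _ (p_even hn))]
      exact serre_three hf (H.serre_b l (by omega) (by omega))
        (H.eSerre (l + 2) (l + 3) (by omega) (by omega) (by omega) (by omega) (by omega)
          (by omega))
  | d + 2 =>
    have ih := H.eb_ge l (d + 1) (by omega)
    have ht : (tt n (l + 1) + tt n (l + 2)) * tt n (l + 2 + (d + 2))
        = (tt n (l + 1) + tt n (l + 2)) * tt n (l + 2 + (d + 1)) := by
      simp only [tt, thetaIdx]
      split_ifs <;> first | omega | decide
    have hc := H.ee (l + 2) (l + 2 + (d + 2)) (by omega) (by omega) (by omega) (by omega)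
      (by omega) (by omega)
    have hb : bC e (l + 2 + (d + 2)) = bC e (l + 2 + (d + 1)) * e (l + 2 + (d + 2))
        - e (l + 2 + (d + 2)) * bC e (l + 2 + (d + 1)) := rfl
    have hs : sb (tt n (l + 1) + tt n (l + 2)) (tt n (l + 2 + (d + 2))) (e (l + 2))
        (bC e (l + 2 + (d + 2)))
        = sb (tt n (l + 1) + tt n (l + 2)) (tt n (l + 2 + (d + 1))) (e (l + 2))
        (bC e (l + 2 + (d + 2))) := by
      simp only [sb, ht]
    rw [hs, hb, sb_comm_right _ _ hc, ih]; simp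

theorem ChSys.eb [Algebra ℂ R] (H : ChSys n N h e f) (l k : ℕ) (hl : l + 2 ≤ N) (hk : 1 ≤ k)
    (hk' : k ≤ N) :
    sb (tt n (l + 1) + tt n (l + 2)) (tt n k) (e (l + 2)) (bC e k)
      = -(if l + 1 = k then bC e (l + 2) else 0) := by
  rcases lt_trichotomy k (l + 1) with hlt | heq | hgt
  · rw [sb_even _ _ (p_mul_t_lt (by omega)), H.eb_far k (l + 2) (by omega) hl,
      if_neg (by omega)]
    simp
  · subst heq
    rw [sb_even _ _ (p_mul_t_lt (by omega)), if_pos rfl, bC, neg_sub]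
  · obtain ⟨d, rfl⟩ := Nat.exists_eq_add_of_le (show l + 2 ≤ k by omega)
    rw [H.eb_ge l d hk', if_neg (by omega), neg_zero]

theorem ChSys.hb (H : ChSys n N h e f) (i k : ℕ) (hi : i + 1 ≤ N) (hk : 1 ≤ k) (hk' : k ≤ N) :
    h (i + 1) * bC e k = bC e k * h (i + 1)
      + ((if i = 0 then 1 else 0) - (if i = k then 1 else 0)
        + chi (tt n i + tt n (i + 1)) * (if i + 1 = k then 1 else 0)) • bC e k := by
  induction k using Nat.strong_induction_on with
  | _ k ih =>
    match k, hk, hk', ih with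
    | 1, _, hk', _ =>
      simp only [bC]
      rw [H.he (i + 1) 1 (by omega) hi (by omega) hk', alpha_eq]
      congr 2
      generalize chi (tt n i + tt n (i + 1)) = c
      split_ifs <;> omega
    | k + 2, _, hk', ih =>
      have h1 := ih (k + 1) (by omega) (by omega) (by omega)
      have h2 := H.he (i + 1) (k + 2) (by omega) hi (by omega) hk'
      simp only [bC]
      rw [comm_br h1 h2, alpha_eq]
      congr 2
      generalize chi (tt n i + tt n (i + 1)) = c
      split_ifs <;> omega

theorem ChSys.fb (H : ChSys n N h e f) (l k : ℕ) (hl : l + 2 ≤ N) (hk : 1 ≤ k) (hk' : k ≤ N) :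
    sb (tt n (l + 1) + tt n (l + 2)) (tt n k) (f (l + 2)) (bC e k)
      = -(if l + 2 = k then chi ((tt n (l + 1) + tt n (l + 2)) * tt n k) • bC e (l + 1) else 0) := by
  have h0 : tt n 0 = 0 := tt_le (by omega)
  induction k using Nat.strong_induction_on with
  | _ k ih =>
    match k, hk, hk', ih with
    | 1, _, hk', _ =>
      have hef := H.ef 1 (l + 2) (by omega) (by omega) (by omega) hl
      rw [if_neg (by omega)] at hef
      simp only [Nat.sub_self, h0, zero_add, show l + 2 - 1 = l + 1 from rfl] at hef
      rw [if_neg (by omega), sb_swap]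
      simp only [bC]
      rw [hef]; simp
    | k + 2, _, hk', ih =>
      have ih := ih (k + 1) (by omega) (by omega) (by omega)
      have hef := H.ef (k + 2) (l + 2) (by omega) hk' (by omega) hl
      simp only [show l + 2 - 1 = l + 1 from rfl, show k + 2 - 1 = k + 1 from rfl] at hef
      by_cases hkl : k = l
      · subst hkl
        have hp := p_mul_t n (k + 1)
        rw [sb_even _ _ hp, if_neg (by omega), neg_zero, sub_eq_zero] at ih
        rw [if_pos rfl, sb, z2_idem] at hef
        have hw := H.hb (k + 1) (k + 1) hl (by omega) (by omega)
        have hp2 : (tt n (k + 1) + tt n (k + 2)) * tt n (k + 2) = tt n (k + 1) + tt n (k + 2) := by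
          have : (tt n (k + 1) + tt n (k + 2)) * tt n (k + 2)
              = (tt n (k + 1) + tt n (k + 2)) * (tt n (k + 1) + tt n (k + 2))
                - (tt n (k + 1) + tt n (k + 2)) * tt n (k + 1) := by ring
          rw [this, hp, z2_idem, sub_zero]
        rw [if_pos rfl, sb, hp2]
        simp only [bC]
        rw [if_neg (by omega), if_pos rfl, if_neg (by omega), mul_zero, ← hef] at hw
        have hcc := chi_mul_self (tt n (k + 1) + tt n (k + 2))
        generalize chi (tt n (k + 1) + tt n (k + 2)) = c at *
        generalize bC e (k + 1) = B at *
        generalize f (k + 2) = y at *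
        generalize e (k + 2) = z at *
        rw [fb_aux hcc ih, hw]
        simp [-zsmul_eq_mul]
      · rw [if_neg (by omega), sb_even _ _ (p_mul_p (by omega)), sub_eq_zero] at hef
        have hp3 := p_mul_p (n := n) (show l + 1 ≠ k + 1 by omega)
        have ht : (tt n (l + 1) + tt n (l + 2)) * tt n (k + 2)
            = (tt n (l + 1) + tt n (l + 2)) * tt n (k + 1) := by
          rw [mul_add] at hp3
          have hz : ∀ x y : ZMod 2, x + y = 0 → y = x := by decide
          exact hz _ _ hp3
        have hs : sb (tt n (l + 1) + tt n (l + 2)) (tt n (k + 2)) (f (l + 2)) (bC e (k + 2))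
            = sb (tt n (l + 1) + tt n (l + 2)) (tt n (k + 1)) (f (l + 2)) (bC e (k + 2)) := by
          simp only [sb, ht]
        rw [hs, bC, sb_comm_right _ _ hef.symm, ih, if_neg (show ¬ (l + 2 = k + 2) by omega)]
        by_cases hk2 : l + 2 = k + 1
        · have hk3 : k = l + 1 := by omega
          subst hk3
          have := H.eb_far (l + 1) (l + 1 + 2) (by omega) hk'
          rw [if_pos rfl, neg_mul, mul_neg, smul_mul_assoc, mul_smul_comm, this]
          simp
        · simp [hk2]

theorem ChSys.Hb (H : ChSys n N h e f) (i k : ℕ) (hi : 1 ≤ i) (hi' : i ≤ N) (hk : 1 ≤ k)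
    (hk' : k ≤ N) :
    hC n h i * bC e k = bC e k * hC n h i
      + (-(if i = k then 1 else 0) - chi (tt n i)) • bC e k := by
  induction i using Nat.strong_induction_on with
  | _ i ih =>
    match i, hi, hi', ih with
    | 1, _, hi', _ =>
      have h0 : tt n 0 = 0 := tt_le (by omega)
      simp only [hC]
      rw [comm_smul (-chi (tt n 1)) (H.hb 0 k hi' hk hk')]
      congr 2
      have := chi_mul_self (tt n 1)
      rw [h0, zero_add, zero_add, if_pos rfl, if_neg (by omega)]
      split_ifs <;> linarith
    | i + 2, _, hi', ih =>
      have h1 := ih (i + 1) (by omega) (by omega) (by omega)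
      have h2 := comm_smul (chi (tt n (i + 1) + tt n (i + 2)))
        (comm_comb 1 h1 (H.hb (i + 1) k hi' hk hk'))
      rw [one_smul] at h2
      simp only [hC]
      rw [h2]
      congr 2
      rcases z2_cases (tt n (i + 1)) with c | c <;> rcases z2_cases (tt n (i + 1 + 1)) with c' | c' <;>
        simp [c, c', chi_zero, chi_one, z2_one_add] <;> split_ifs <;> omega

theorem ChSys.He (H : ChSys n N h e f) (i k : ℕ) (hi : 1 ≤ i) (hk : i + 1 ≤ k)
    (hk' : k ≤ N) :
    hC n h i * e k = e k * hC n h i + (if i + 1 = k then 1 else 0 : ℤ) • e k := by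
  induction i using Nat.strong_induction_on with
  | _ i ih =>
    match i, hi, hk, ih with
    | 1, _, hk, _ =>
      have h0 : tt n 0 = 0 := tt_le (by omega)
      simp only [hC]
      rw [comm_smul (-chi (tt n 1)) (H.he 1 k (by omega) (by omega) (by omega) hk'), alpha_eq]
      congr 2
      have := chi_mul_self (tt n 1)
      rw [h0, zero_add, zero_add, if_neg (by omega), if_neg (show ¬ (0 = k) by omega)]
      split_ifs <;> linarith
    | i + 2, _, hk, ih =>
      have h1 := ih (i + 1) (by omega) (by omega) (by omega)
      have h2 := comm_smul (chi (tt n (i + 1) + tt n (i + 2)))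
        (comm_comb 1 h1 (H.he (i + 2) k (by omega) (by omega) (by omega) hk'))
      rw [one_smul, alpha_eq] at h2
      simp only [hC]
      rw [h2]
      congr 2
      have := chi_mul_self (tt n (i + 1) + tt n (i + 2))
      rw [if_neg (by omega), if_neg (show ¬ (i + 1 = k) by omega)]
      split_ifs <;> first | omega | linarith

open MulOpposite in
theorem ChSys.ae (H : ChSys n N h e f) (l k : ℕ) (hl : l + 2 ≤ N) (hk : 1 ≤ k) (hk' : k ≤ N) :
    sb (tt n k) (tt n (l + 1) + tt n (l + 2)) (aC f k) (e (l + 2))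
      = -(if l + 2 = k then chi ((tt n (l + 1) + tt n (l + 2)) * tt n k) • aC f (l + 1) else 0) := by
  have := congrArg unop (H.dual.fb l k hl hk hk')
  simp only [bC_op, sb_op', unop_op, unop_neg] at this
  rw [this]
  split_ifs <;> simp [-zsmul_eq_mul]

theorem ChSys.ab_up (H : ChSys n N h e f) (k : ℕ) (hk : k + 2 ≤ N)
    (hK : sb (tt n (k + 1)) (tt n (k + 1)) (aC f (k + 1)) (bC e (k + 1)) = hC n h (k + 1)) :
    sb (tt n (k + 1)) (tt n (k + 2)) (aC f (k + 1)) (bC e (k + 2)) = e (k + 2) := by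
  have hb : bC e (k + 2) = sb (tt n (k + 1)) (tt n (k + 1) + tt n (k + 2)) (bC e (k + 1)) (e (k + 2)) := by
    rw [sb_even _ _ (by rw [mul_comm]; exact p_mul_t n (k + 1)), bC]
  have ht : tt n (k + 1) + (tt n (k + 1) + tt n (k + 2)) = tt n (k + 2) := by
    rw [add_comm, z2_cancel']
  have hj := sb_jac (tt n (k + 1)) (tt n (k + 1)) (tt n (k + 1) + tt n (k + 2)) (aC f (k + 1))
    (bC e (k + 1)) (e (k + 2))
  rw [← hb, ht, hK, H.ae k (k + 1) hk (by omega) (by omega), if_neg (by omega), neg_zero,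
    sb_zero_right, smul_zero, add_zero, z2_add_self, sb_even _ _ (zero_mul _)] at hj
  rw [hj, H.He (k + 1) (k + 2) (by omega) (by omega) hk]
  simp

open MulOpposite in
theorem ChSys.ab_down (H : ChSys n N h e f) (k : ℕ) (hk : k + 2 ≤ N)
    (hK : sb (tt n (k + 1)) (tt n (k + 1)) (aC f (k + 1)) (bC e (k + 1)) = hC n h (k + 1)) :
    sb (tt n (k + 2)) (tt n (k + 1)) (aC f (k + 2)) (bC e (k + 1)) = f (k + 2) := by
  have := congrArg unop (H.dual.ab_up k hk (by simp only [bC_op, aC_op, hC_op, sb_op', hK]))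
  simpa only [bC_op, aC_op, sb_op', unop_op] using this

theorem z2_sign (x y : ZMod 2) :
    chi (y * x) * (chi ((x + y) * y) * chi (x * x)) = chi (x + y) := by
  revert x y; decide

theorem ChSys.ab_diag (H : ChSys n N h e f) (i : ℕ) (hi : 1 ≤ i) (hi' : i ≤ N) :
    sb (tt n i) (tt n i) (aC f i) (bC e i) = hC n h i := by
  induction i using Nat.strong_induction_on with
  | _ i ih =>
    match i, hi, hi', ih with
    | 1, _, hi', _ =>
      have h0 : tt n 0 = 0 := tt_le (by omega)
      have hef := H.ef 1 1 (by omega) hi' (by omega) hi'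
      simp only [Nat.sub_self, h0, zero_add, if_true] at hef
      simp only [aC, bC, hC]
      rw [sb_swap, hef, z2_idem]
    | k + 2, _, hk, ih =>
      have hK := ih (k + 1) (by omega) (by omega) (by omega)
      have hb : bC e (k + 2)
          = sb (tt n (k + 1)) (tt n (k + 1) + tt n (k + 2)) (bC e (k + 1)) (e (k + 2)) := by
        rw [sb_even _ _ (by rw [mul_comm]; exact p_mul_t n (k + 1)), bC]
      have ht : tt n (k + 1) + (tt n (k + 1) + tt n (k + 2)) = tt n (k + 2) := by
        rw [add_comm, z2_cancel']
      have ht2 : tt n (k + 2) + (tt n (k + 1) + tt n (k + 2)) = tt n (k + 1) := by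
        rw [add_comm, z2_cancel]
      have hj := sb_jac (tt n (k + 2)) (tt n (k + 1)) (tt n (k + 1) + tt n (k + 2)) (aC f (k + 2))
        (bC e (k + 1)) (e (k + 2))
      have hef := H.ef (k + 2) (k + 2) (by omega) hk (by omega) hk
      rw [if_pos rfl] at hef
      simp only [show k + 2 - 1 = k + 1 from rfl] at hef
      rw [← hb, ht, ht2, H.ab_down k hk hK, H.ae k (k + 2) hk (by omega) hk, if_pos rfl,
        sb_neg_right, sb_smul_right, add_comm (tt n (k + 2)), sb_swap _ _ (f (k + 2)), hef,
        sb_swap _ _ (bC e (k + 1)), hK, z2_idem] at hj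
      rw [hj, hC, smul_sub]
      simp only [neg_smul, smul_neg, neg_neg, smul_smul]
      rw [z2_sign]
      abel

theorem ChSys.tm [Algebra ℂ R] (H : ChSys n N h e f) (i j k : ℕ) (hi : 1 ≤ i) (hi' : i ≤ N)
    (hj : 1 ≤ j) (hj' : j ≤ N) (hk : 1 ≤ k) (hk' : k ≤ N) (h1 : i ≤ j + 1) (h2 : j ≤ i + 1) :
    sb (tt n i + tt n j) (tt n k) (sb (tt n i) (tt n j) (aC f i) (bC e j)) (bC e k)
      = -(if i = k then chi ((tt n i + tt n j) * tt n k) • bC e j else 0)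
        - (if i = j then chi (tt n i) • bC e k else 0) := by
  have hc : i = j ∨ j = i + 1 ∨ i = j + 1 := by omega
  rcases hc with rfl | rfl | rfl
  · rw [H.ab_diag i hi hi', z2_add_self, zero_mul, sb_even _ _ (zero_mul _),
      H.Hb i k hi hi' hk hk', chi_zero, if_pos rfl, one_smul, sub_smul]
    by_cases c : i = k
    · subst c; simp
    · simp [c]
  · obtain ⟨l, rfl⟩ := Nat.exists_eq_add_of_le' hi
    rw [H.ab_up l hj' (H.ab_diag _ (by omega) (by omega)), H.eb l k hj' hk hk',
      if_neg (show ¬ (l + 1 = l + 1 + 1) by omega), sub_zero]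
    split_ifs with hc
    · subst hc; rw [p_mul_t, chi_zero, one_smul]
    · rfl
  · obtain ⟨l, rfl⟩ := Nat.exists_eq_add_of_le' hj
    rw [H.ab_down l hi' (H.ab_diag _ (by omega) (by omega)), add_comm (tt n (l + 1 + 1)),
      H.fb l k hi' hk hk', if_neg (show ¬ (l + 1 + 1 = l + 1) by omega), sub_zero]

theorem ChSys.bb12 (H : ChSys n N h e f) (hN : 2 ≤ N) :
    sb (tt n 1) (tt n 2) (bC e 1) (bC e 2) = 0 := by
  by_cases hn : n = 0
  · subst hn
    have hs := H.esq
    rw [sb_odd _ _ (by rw [tt_gt (by omega), tt_gt (by omega)]; rfl)]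
    simp only [bC, zero_add] at hs ⊢
    have : e 1 * (e 1 * e 2 - e 2 * e 1) + (e 1 * e 2 - e 2 * e 1) * e 1
        = (e 1 * e 1) * e 2 - e 2 * (e 1 * e 1) := by noncomm_ring
    rw [this, hs]; simp
  · have hs := H.eSerre 1 2 (by omega) (by omega) (by omega) hN (by omega) (by omega)
    rw [sb_even _ _ (by rw [tt_le (by omega), zero_mul]), ← hs]
    simp only [bC]
    noncomm_ring

open MulOpposite in
theorem ChSys.toA [Algebra ℂ R] (H : ChSys n N h e f) : ASys n N (aC f) (bC e) where
  aa12 hN := by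
    have := H.dual.bb12 hN
    rw [bC_op, bC_op, sb_op] at this
    have := congrArg (fun x => - chi (tt n 1 * tt n 2) • unop x) this
    simpa only [unop_smul, unop_op, smul_smul, unop_zero, smul_zero, neg_mul_neg, chi_mul_self,
      one_smul] using this
  bb12 hN := H.bb12 hN
  aa11 hn := by subst hn; exact H.fsq
  bb11 hn := by subst hn; exact H.esq
  tp i j k h1 h2 h3 h4 h5 h6 h7 h8 := by
    have := H.dual.tm j i k h3 h4 h1 h2 h5 h6 h8 h7
    simp only [bC_op, aC_op] at this
    rw [sb_op', sb_op, add_comm (tt n j)] at this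
    have := congrArg (fun x => - chi ((tt n i + tt n j) * tt n k) • unop x) this
    simp only [unop_smul, unop_op, smul_smul, neg_mul_neg, chi_mul_self, one_smul] at this
    rw [this]
    by_cases hij : i = j
    · subst hij
      simp only [z2_add_self, zero_mul, chi_zero]
      split_ifs <;> simp [-zsmul_eq_mul] <;> abel
    · simp only [hij, Ne.symm hij, if_false]
      split_ifs
      · simp [smul_smul, chi_mul_self, -zsmul_eq_mul]
      · simp
  tm := H.tm

end ChtoA

section Assembly

theorem sgn_smul {R : Type*} [Ring R] [Algebra ℂ R] (k : ℕ) (x : R) :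
    ((-1 : ℂ) ^ k) • x = chi (k : ZMod 2) • x := by
  rw [chi_cast, ← Int.cast_smul_eq_zsmul ℂ]
  push_cast
  rfl

theorem int_smul {R : Type*} [Ring R] [Algebra ℂ R] (k : ℤ) (x : R) :
    (k : ℂ) • x = k • x := Int.cast_smul_eq_zsmul ℂ k x

theorem tt_cast (n i : ℕ) : (thetaIdx n i : ZMod 2) = tt n i := rfl

theorem p_cast (n i : ℕ) : (pIdx n i : ZMod 2) = tt n (i - 1) + tt n i := by
  simp [pIdx, tt]

theorem p_cast_even {n i : ℕ} (hi : 1 ≤ i) (h : i ≠ n + 1) : (pIdx n i : ZMod 2) = 0 := by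
  obtain ⟨l, rfl⟩ := Nat.exists_eq_add_of_le' hi
  rw [p_cast]
  exact p_even (by omega)

theorem p_cast_odd (n : ℕ) : (pIdx n (n + 1) : ZMod 2) = 1 := by
  rw [p_cast]
  exact p_odd n

/-- A homomorphism killing the Chevalley relations gives a Chevalley system. -/
theorem chSys_of_hom {n m : ℕ} (hm : 1 ≤ m) {R : Type*} [Ring R] [Algebra ℂ R]
    (g : FreeAlgebra ℂ (ChGen (n + m)) →ₐ[ℂ] R) (hg : ∀ x y, chRel n m x y → g x = g y) :
    ChSys n (n + m) (fun i => g (hG (n + m) i)) (fun i => g (eG (n + m) i))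
      (fun i => g (fG (n + m) i)) where
  hh i j h1 h2 h3 h4 := by simpa using hg _ _ (chRel.hh i j ⟨h1, h2⟩ ⟨h3, h4⟩)
  he i j h1 h2 h3 h4 := by
    have := hg _ _ (chRel.he i j ⟨h1, h2⟩ ⟨h3, h4⟩)
    simpa only [map_mul, map_add, map_sub, map_smul, map_zsmul, map_neg, map_zero, apply_ite g, int_smul] using this
  hf i j h1 h2 h3 h4 := by
    have := hg _ _ (chRel.hf i j ⟨h1, h2⟩ ⟨h3, h4⟩)
    simpa only [map_mul, map_add, map_sub, map_smul, map_zsmul, map_neg, map_zero, apply_ite g, int_smul] using this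
  ef i j h1 h2 h3 h4 := by
    have := hg _ _ (chRel.ef i j ⟨h1, h2⟩ ⟨h3, h4⟩)
    simp only [map_mul, map_add, map_sub, map_smul, map_zsmul, map_neg, map_zero, apply_ite g, sgn_smul, Nat.cast_mul, p_cast, ite_smul,
      one_smul, zero_smul] at this
    exact this
  ee i j h1 h2 h3 h4 h5 h6 := by simpa using hg _ _ (chRel.ee i j ⟨h1, h2⟩ ⟨h3, h4⟩ ⟨h5, h6⟩)
  ff i j h1 h2 h3 h4 h5 h6 := by simpa using hg _ _ (chRel.ff i j ⟨h1, h2⟩ ⟨h3, h4⟩ ⟨h5, h6⟩)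
  esq := by simpa using hg _ _ (chRel.esq (by omega))
  fsq := by simpa using hg _ _ (chRel.fsq (by omega))
  eSerre i j h1 h2 h3 h4 h5 h6 := by
    have := hg _ _ (chRel.eSerre i j ⟨h1, h2⟩ ⟨h3, h4⟩ h5)
    simp only [map_mul, map_add, map_sub, map_smul, map_zsmul, map_neg, map_zero, apply_ite g, sgn_smul, Nat.cast_mul, p_cast_even h1 h6,
      zero_mul, chi_zero, one_smul, map_zero] at this
    rw [← this]
    noncomm_ring
  fSerre i j h1 h2 h3 h4 h5 h6 := by
    have := hg _ _ (chRel.fSerre i j ⟨h1, h2⟩ ⟨h3, h4⟩ h5)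
    simp only [map_mul, map_add, map_sub, map_smul, map_zsmul, map_neg, map_zero, apply_ite g, sgn_smul, Nat.cast_mul, p_cast_even h1 h6,
      zero_mul, chi_zero, one_smul, map_zero] at this
    rw [← this]
    noncomm_ring
  eAdd h1 h2 := by simpa using hg _ _ (chRel.eAdd h1 h2)
  fAdd h1 h2 := by simpa using hg _ _ (chRel.fAdd h1 h2)

/-- A homomorphism killing the relations (18) gives a creation-annihilation system. -/
theorem aSys_of_hom {n m : ℕ} {R : Type*} [Ring R] [Algebra ℂ R]
    (g : FreeAlgebra ℂ (AGen (n + m)) →ₐ[ℂ] R) (hg : ∀ x y, aRel n m x y → g x = g y) :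
    ASys n (n + m) (fun i => g (aPG (n + m) i)) (fun i => g (aMG (n + m) i)) where
  aa12 h := by
    have := hg _ _ (aRel.a12plus h)
    simpa only [map_mul, map_sub, map_smul, map_zsmul, sgn_smul, Nat.cast_mul, tt_cast, map_zero, sb] using this
  bb12 h := by
    have := hg _ _ (aRel.a12minus h)
    simpa only [map_mul, map_sub, map_smul, map_zsmul, sgn_smul, Nat.cast_mul, tt_cast, map_zero, sb] using this
  aa11 h := by
    subst h
    have := hg _ _ aRel.a11plus
    simp only [map_mul, map_sub, map_smul, map_zsmul, map_neg, map_zero, apply_ite g, sgn_smul, Nat.cast_mul, tt_cast, map_zero,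
      tt_gt (show ¬ 1 ≤ 0 by omega), mul_one, chi_one, neg_smul, one_smul, sub_neg_eq_add] at this
    rw [← two_smul ℂ] at this
    simpa using this
  bb11 h := by
    subst h
    have := hg _ _ aRel.a11minus
    simp only [map_mul, map_sub, map_smul, map_zsmul, map_neg, map_zero, apply_ite g, sgn_smul, Nat.cast_mul, tt_cast, map_zero,
      tt_gt (show ¬ 1 ≤ 0 by omega), mul_one, chi_one, neg_smul, one_smul, sub_neg_eq_add] at this
    rw [← two_smul ℂ] at this
    simpa using this
  tp i j k h1 h2 h3 h4 h5 h6 h7 h8 := by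
    have := hg _ _ (aRel.triplePlus i j k ⟨h1, h2⟩ ⟨h3, h4⟩ ⟨h5, h6⟩ ⟨h7, h8⟩)
    simp only [map_mul, map_add, map_sub, map_smul, map_zsmul, map_neg, map_zero, apply_ite g, sgn_smul, Nat.cast_mul, Nat.cast_add, tt_cast,
      ite_smul, mul_ite, mul_one, mul_zero, one_smul, zero_smul] at this
    exact this
  tm i j k h1 h2 h3 h4 h5 h6 h7 h8 := by
    have := hg _ _ (aRel.tripleMinus i j k ⟨h1, h2⟩ ⟨h3, h4⟩ ⟨h5, h6⟩ ⟨h7, h8⟩)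
    simp only [map_mul, map_add, map_sub, map_neg, map_smul, map_zsmul, map_neg, map_zero, apply_ite g, sgn_smul, Nat.cast_mul, Nat.cast_add,
      tt_cast, ite_smul, mul_ite, mul_one, mul_zero, one_smul, zero_smul] at this
    exact this

/-- A Chevalley system gives a homomorphism killing the Chevalley relations. -/
theorem ChSys.respects {n m : ℕ} {R : Type*} [Ring R] [Algebra ℂ R] {h e f : ℕ → R}
    (H : ChSys n (n + m) h e f) (g : FreeAlgebra ℂ (ChGen (n + m)) →ₐ[ℂ] R)
    (gh : ∀ i, (1 ≤ i ∧ i ≤ n + m) → g (hG (n + m) i) = h i)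
    (ge : ∀ i, (1 ≤ i ∧ i ≤ n + m) → g (eG (n + m) i) = e i)
    (gf : ∀ i, (1 ≤ i ∧ i ≤ n + m) → g (fG (n + m) i) = f i)
    {x y : FreeAlgebra ℂ (ChGen (n + m))} (r : chRel n m x y) : g x = g y := by
  cases r with
  | hh i j hi hj => simp only [map_mul, gh i hi, gh j hj, H.hh i j hi.1 hi.2 hj.1 hj.2]
  | he i j hi hj =>
    simp only [map_mul, map_add, map_smul, map_zsmul, map_neg, map_zero, apply_ite g, int_smul, gh i hi, ge j hj, H.he i j hi.1 hi.2 hj.1 hj.2]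
  | hf i j hi hj =>
    simp only [map_mul, map_sub, map_smul, map_zsmul, map_neg, map_zero, apply_ite g, int_smul, gh i hi, gf j hj, H.hf i j hi.1 hi.2 hj.1 hj.2]
  | ef i j hi hj =>
    have := H.ef i j hi.1 hi.2 hj.1 hj.2
    simp only [map_mul, map_sub, map_smul, map_zsmul, map_neg, map_zero, apply_ite g, sgn_smul, Nat.cast_mul, p_cast, ite_smul,
      one_smul, zero_smul, apply_ite g, map_zero, gh i hi, ge i hi, gf j hj]
    exact this
  | ee i j hi hj hij =>
    simp only [map_mul, ge i hi, ge j hj, H.ee i j hi.1 hi.2 hj.1 hj.2 hij.1 hij.2]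
  | ff i j hi hj hij =>
    simp only [map_mul, gf i hi, gf j hj, H.ff i j hi.1 hi.2 hj.1 hj.2 hij.1 hij.2]
  | esq h => rw [map_mul, ge _ ⟨by omega, h⟩, H.esq, map_zero]
  | fsq h => rw [map_mul, gf _ ⟨by omega, h⟩, H.fsq, map_zero]
  | eSerre i j hi hj hij =>
    simp only [map_mul, map_sub, map_smul, map_zsmul, map_neg, map_zero, apply_ite g, sgn_smul, Nat.cast_mul, Nat.cast_add, ge i hi, ge j hj,
      map_zero]
    by_cases c : i = n + 1
    · have cj : (pIdx n j : ZMod 2) = 0 := p_cast_even hj.1 (by omega)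
      have hs := H.esq
      rw [← c] at hs
      have ci : (pIdx n i : ZMod 2) = 1 := by rw [c, p_cast_odd]
      simp only [cj, ci, mul_zero, add_zero, mul_one, chi_zero, chi_one, one_smul, neg_smul]
      have : e i * (e i * e j - e j * e i) - -((e i * e j - e j * e i) * e i)
        = (e i * e i) * e j - e j * (e i * e i) := by noncomm_ring
      rw [this, hs]; simp
    · have hs := H.eSerre i j hi.1 hi.2 hj.1 hj.2 hij c
      simp only [p_cast_even hi.1 c, zero_mul, chi_zero, one_smul]
      rw [← hs]
      noncomm_ring
  | fSerre i j hi hj hij =>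
    simp only [map_mul, map_sub, map_smul, map_zsmul, map_neg, map_zero, apply_ite g, sgn_smul, Nat.cast_mul, Nat.cast_add, gf i hi, gf j hj,
      map_zero]
    by_cases c : i = n + 1
    · have cj : (pIdx n j : ZMod 2) = 0 := p_cast_even hj.1 (by omega)
      have hs := H.fsq
      rw [← c] at hs
      have ci : (pIdx n i : ZMod 2) = 1 := by rw [c, p_cast_odd]
      simp only [cj, ci, mul_zero, add_zero, mul_one, chi_zero, chi_one, one_smul, neg_smul]
      have : f i * (f i * f j - f j * f i) - -((f i * f j - f j * f i) * f i)
        = (f i * f i) * f j - f j * (f i * f i) := by noncomm_ring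
      rw [this, hs]; simp
    · have hs := H.fSerre i j hi.1 hi.2 hj.1 hj.2 hij c
      simp only [p_cast_even hi.1 c, zero_mul, chi_zero, one_smul]
      rw [← hs]
      noncomm_ring
  | eAdd hn hN =>
    simp only [map_mul, map_sub, map_add, ge (n + 1) ⟨by omega, by omega⟩,
      ge n ⟨by omega, by omega⟩, ge (n + 2) ⟨by omega, by omega⟩, H.eAdd hn hN, map_zero]
  | fAdd hn hN =>
    simp only [map_mul, map_sub, map_add, gf (n + 1) ⟨by omega, by omega⟩,
      gf n ⟨by omega, by omega⟩, gf (n + 2) ⟨by omega, by omega⟩, H.fAdd hn hN, map_zero]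

/-- A creation-annihilation system gives a homomorphism killing the relations (18). -/
theorem ASys.respects {n m : ℕ} (hm : 1 ≤ m) {R : Type*} [Ring R] [Algebra ℂ R] {a b : ℕ → R}
    (H : ASys n (n + m) a b) (g : FreeAlgebra ℂ (AGen (n + m)) →ₐ[ℂ] R)
    (ga : ∀ i, (1 ≤ i ∧ i ≤ n + m) → g (aPG (n + m) i) = a i)
    (gb : ∀ i, (1 ≤ i ∧ i ≤ n + m) → g (aMG (n + m) i) = b i)
    {x y : FreeAlgebra ℂ (AGen (n + m))} (r : aRel n m x y) : g x = g y := by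
  have h1 : 1 ≤ 1 ∧ 1 ≤ n + m := ⟨le_refl 1, by omega⟩
  cases r with
  | a12plus h =>
    have := H.aa12 h
    simp only [map_mul, map_sub, map_smul, map_zsmul, map_neg, map_zero, apply_ite g, sgn_smul, Nat.cast_mul, tt_cast, map_zero, ga 1 h1,
      ga 2 ⟨by omega, h⟩]
    exact this
  | a12minus h =>
    have := H.bb12 h
    simp only [map_mul, map_sub, map_smul, map_zsmul, map_neg, map_zero, apply_ite g, sgn_smul, Nat.cast_mul, tt_cast, map_zero, gb 1 h1,
      gb 2 ⟨by omega, h⟩]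
    exact this
  | a11plus =>
    simp only [map_mul, map_sub, map_smul, map_zsmul, map_neg, map_zero, apply_ite g, sgn_smul, Nat.cast_mul, tt_cast, map_zero, ga 1 h1]
    by_cases c : n = 0
    · simp [H.aa11 c]
    · simp [tt_le (show 1 ≤ n by omega), chi_zero]
  | a11minus =>
    simp only [map_mul, map_sub, map_smul, map_zsmul, map_neg, map_zero, apply_ite g, sgn_smul, Nat.cast_mul, tt_cast, map_zero, gb 1 h1]
    by_cases c : n = 0
    · simp [H.bb11 c]
    · simp [tt_le (show 1 ≤ n by omega), chi_zero]
  | triplePlus i j k hi hj hk hij =>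
    have := H.tp i j k hi.1 hi.2 hj.1 hj.2 hk.1 hk.2 hij.1 hij.2
    simp only [map_mul, map_add, map_sub, map_smul, map_zsmul, map_neg, map_zero, apply_ite g, sgn_smul, Nat.cast_mul, Nat.cast_add, tt_cast,
      ite_smul, mul_ite, mul_one, mul_zero, one_smul, zero_smul, ga i hi, ga k hk, gb j hj,
      apply_ite g, map_zero, map_zsmul]
    exact this
  | tripleMinus i j k hi hj hk hij =>
    have := H.tm i j k hi.1 hi.2 hj.1 hj.2 hk.1 hk.2 hij.1 hij.2
    simp only [map_mul, map_add, map_sub, map_neg, map_smul, map_zsmul, map_neg, map_zero, apply_ite g, sgn_smul, Nat.cast_mul, Nat.cast_add,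
      tt_cast, ite_smul, mul_ite, mul_one, mul_zero, one_smul, zero_smul, ga i hi, gb k hk,
      gb j hj, apply_ite g, map_zero, map_zsmul]
    exact this

/-- The homomorphism out of the free algebra on creation-annihilation generators. -/
noncomputable def aHom {R : Type*} [Ring R] [Algebra ℂ R] (N : ℕ) (a b : ℕ → R) :
    FreeAlgebra ℂ (AGen N) →ₐ[ℂ] R :=
  FreeAlgebra.lift ℂ (fun x => match x with
    | AGen.plus i => a i.1
    | AGen.minus i => b i.1)

/-- The homomorphism out of the free algebra on Chevalley generators. -/
noncomputable def cHom {R : Type*} [Ring R] [Algebra ℂ R] (N : ℕ) (h e f : ℕ → R) :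
    FreeAlgebra ℂ (ChGen N) →ₐ[ℂ] R :=
  FreeAlgebra.lift ℂ (fun x => match x with
    | ChGen.h i => h i.1
    | ChGen.e i => e i.1
    | ChGen.f i => f i.1)

theorem aHom_P {R : Type*} [Ring R] [Algebra ℂ R] {N : ℕ} (a b : ℕ → R) (i : ℕ)
    (hi : 1 ≤ i ∧ i ≤ N) : aHom N a b (aPG N i) = a i := by
  simp [aHom, aPG, hi]

theorem aHom_M {R : Type*} [Ring R] [Algebra ℂ R] {N : ℕ} (a b : ℕ → R) (i : ℕ)
    (hi : 1 ≤ i ∧ i ≤ N) : aHom N a b (aMG N i) = b i := by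
  simp [aHom, aMG, hi]

theorem cHom_h {R : Type*} [Ring R] [Algebra ℂ R] {N : ℕ} (h e f : ℕ → R) (i : ℕ)
    (hi : 1 ≤ i ∧ i ≤ N) : cHom N h e f (hG N i) = h i := by
  simp [cHom, hG, hi]

theorem cHom_e {R : Type*} [Ring R] [Algebra ℂ R] {N : ℕ} (h e f : ℕ → R) (i : ℕ)
    (hi : 1 ≤ i ∧ i ≤ N) : cHom N h e f (eG N i) = e i := by
  simp [cHom, eG, hi]

theorem cHom_f {R : Type*} [Ring R] [Algebra ℂ R] {N : ℕ} (h e f : ℕ → R) (i : ℕ)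
    (hi : 1 ≤ i ∧ i ≤ N) : cHom N h e f (fG N i) = f i := by
  simp [cHom, fG, hi]

/-- The image of `h_i` in the quotient. -/
noncomputable def hQ (n m i : ℕ) : RingQuot (chRel n m) :=
  RingQuot.mkAlgHom ℂ (chRel n m) (hG (n + m) i)

theorem chQ {n m : ℕ} (hm : 1 ≤ m) : ChSys n (n + m) (hQ n m) (eQ n m) (fQ n m) :=
  chSys_of_hom hm (RingQuot.mkAlgHom ℂ (chRel n m)) (fun _ _ r => RingQuot.mkAlgHom_rel ℂ r)

theorem aQ (n m : ℕ) : ASys n (n + m) (aPQ n m) (aMQ n m) :=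
  aSys_of_hom (RingQuot.mkAlgHom ℂ (aRel n m)) (fun _ _ r => RingQuot.mkAlgHom_rel ℂ r)

/-- The map `φ`. -/
noncomputable def phi {n m : ℕ} (hm : 1 ≤ m) : RingQuot (aRel n m) →ₐ[ℂ] RingQuot (chRel n m) :=
  RingQuot.liftAlgHom ℂ ⟨aHom (n + m) (aC (fQ n m)) (bC (eQ n m)), fun _ _ r =>
    (chQ hm).toA.respects hm _ (aHom_P _ _) (aHom_M _ _) r⟩

/-- The inverse of `φ`. -/
noncomputable def psi {n m : ℕ} (hm : 1 ≤ m) : RingQuot (chRel n m) →ₐ[ℂ] RingQuot (aRel n m) :=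
  RingQuot.liftAlgHom ℂ ⟨cHom (n + m) (hA n (aPQ n m) (aMQ n m)) (eA n (aPQ n m) (aMQ n m))
    (fA n (aPQ n m) (aMQ n m)), fun _ _ r =>
    ((aQ n m).toCh (by omega)).respects _ (cHom_h _ _ _) (cHom_e _ _ _) (cHom_f _ _ _) r⟩

variable {n m : ℕ} (hm : 1 ≤ m)

theorem phi_P (i : ℕ) (hi : 1 ≤ i ∧ i ≤ n + m) : phi hm (aPQ n m i) = aC (fQ n m) i := by
  rw [phi, aPQ, RingQuot.liftAlgHom_mkAlgHom_apply, aHom_P _ _ i hi]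

theorem phi_M (i : ℕ) (hi : 1 ≤ i ∧ i ≤ n + m) : phi hm (aMQ n m i) = bC (eQ n m) i := by
  rw [phi, aMQ, RingQuot.liftAlgHom_mkAlgHom_apply, aHom_M _ _ i hi]

theorem psi_h (i : ℕ) (hi : 1 ≤ i ∧ i ≤ n + m) :
    psi hm (hQ n m i) = hA n (aPQ n m) (aMQ n m) i := by
  rw [psi, hQ, RingQuot.liftAlgHom_mkAlgHom_apply, cHom_h _ _ _ i hi]

theorem psi_e (i : ℕ) (hi : 1 ≤ i ∧ i ≤ n + m) :
    psi hm (eQ n m i) = eA n (aPQ n m) (aMQ n m) i := by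
  rw [psi, eQ, RingQuot.liftAlgHom_mkAlgHom_apply, cHom_e _ _ _ i hi]

theorem psi_f (i : ℕ) (hi : 1 ≤ i ∧ i ≤ n + m) :
    psi hm (fQ n m i) = fA n (aPQ n m) (aMQ n m) i := by
  rw [psi, fQ, RingQuot.liftAlgHom_mkAlgHom_apply, cHom_f _ _ _ i hi]

theorem map_sb {A B : Type*} [Ring A] [Ring B] [Algebra ℂ A] [Algebra ℂ B] (g : A →ₐ[ℂ] B)
    (c d : ZMod 2) (x y : A) : g (sb c d x y) = sb c d (g x) (g y) := by
  simp only [sb, map_sub, map_mul, map_zsmul]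

theorem psi_b (i : ℕ) (hi : 1 ≤ i) (hi' : i ≤ n + m) :
    psi hm (bC (eQ n m) i) = aMQ n m i := by
  induction i using Nat.strong_induction_on with
  | _ i ih =>
    match i, hi, hi', ih with
    | 1, _, hi', _ => simp only [bC]; rw [psi_e hm 1 ⟨le_refl 1, hi'⟩, eA]
    | k + 2, _, hk, ih =>
      have h1 := ih (k + 1) (by omega) (by omega) (by omega)
      have h2 := (aQ n m).tm (k + 1) (k + 2) (k + 1) (by omega) (by omega) (by omega) hk
        (by omega) (by omega) (by omega) (by omega)
      rw [sb_even _ _ (p_mul_t n (k + 1)), if_pos rfl, if_neg (by omega), p_mul_t, chi_zero,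
        one_smul, sub_zero] at h2
      rw [bC, map_sub, map_mul, map_mul, h1, psi_e hm (k + 2) ⟨by omega, hk⟩, eA, EE,
        ← neg_sub, h2, neg_neg]

theorem psi_a (i : ℕ) (hi : 1 ≤ i) (hi' : i ≤ n + m) :
    psi hm (aC (fQ n m) i) = aPQ n m i := by
  induction i using Nat.strong_induction_on with
  | _ i ih =>
    match i, hi, hi', ih with
    | 1, _, hi', _ => simp only [aC]; rw [psi_f hm 1 ⟨le_refl 1, hi'⟩, fA]
    | k + 2, _, hk, ih =>
      have h1 := ih (k + 1) (by omega) (by omega) (by omega)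
      have h2 := (aQ n m).tp (k + 2) (k + 1) (k + 1) (by omega) (by omega) (by omega) (by omega)
        (by omega) (by omega) (by omega) (by omega)
      rw [sb_even _ _ (by rw [add_comm]; exact p_mul_t n (k + 1)), if_pos rfl,
        if_neg (by omega), add_zero] at h2
      rw [aC, map_sub, map_mul, map_mul, h1, psi_f hm (k + 2) ⟨by omega, hk⟩, fA, EE, h2]

theorem phi_EE (i j : ℕ) (hi : 1 ≤ i ∧ i ≤ n + m) (hj : 1 ≤ j ∧ j ≤ n + m) :
    phi hm (EE n (aPQ n m) (aMQ n m) i j)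
      = sb (tt n i) (tt n j) (aC (fQ n m) i) (bC (eQ n m) j) := by
  rw [EE, map_sb, phi_P hm i hi, phi_M hm j hj]

theorem phi_eA (i : ℕ) (hi : 1 ≤ i) (hi' : i ≤ n + m) :
    phi hm (eA n (aPQ n m) (aMQ n m) i) = eQ n m i := by
  match i, hi, hi' with
  | 1, _, hi' => rw [eA, phi_M hm 1 ⟨le_refl 1, hi'⟩, bC]
  | k + 2, _, hk =>
    rw [eA, phi_EE hm _ _ ⟨by omega, by omega⟩ ⟨by omega, hk⟩,
      (chQ hm).ab_up k hk ((chQ hm).ab_diag _ (by omega) (by omega))]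

theorem phi_fA (i : ℕ) (hi : 1 ≤ i) (hi' : i ≤ n + m) :
    phi hm (fA n (aPQ n m) (aMQ n m) i) = fQ n m i := by
  match i, hi, hi' with
  | 1, _, hi' => rw [fA, phi_P hm 1 ⟨le_refl 1, hi'⟩, aC]
  | k + 2, _, hk =>
    rw [fA, phi_EE hm _ _ ⟨by omega, hk⟩ ⟨by omega, by omega⟩,
      (chQ hm).ab_down k hk ((chQ hm).ab_diag _ (by omega) (by omega))]

theorem phi_hA (i : ℕ) (hi : 1 ≤ i) (hi' : i ≤ n + m) :
    phi hm (hA n (aPQ n m) (aMQ n m) i) = hQ n m i := by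
  match i, hi, hi' with
  | 1, _, hi' =>
    rw [hA, map_zsmul, phi_EE hm _ _ ⟨by omega, by omega⟩ ⟨by omega, hi'⟩,
      (chQ hm).ab_diag _ (by omega) (by omega), hC, smul_smul, neg_mul_neg, chi_mul_self, one_smul]
  | k + 2, _, hk =>
    rw [hA, map_sub, map_zsmul, phi_EE hm _ _ ⟨by omega, by omega⟩ ⟨by omega, by omega⟩,
      phi_EE hm _ _ ⟨by omega, hk⟩ ⟨by omega, hk⟩,
      (chQ hm).ab_diag (k + 1) (by omega) (by omega),
      (chQ hm).ab_diag (k + 2) (by omega) (by omega), hC, smul_smul, chi_mul_self, one_smul,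
      sub_sub_cancel]

/-- The isomorphism. -/
noncomputable def phiEquiv : RingQuot (aRel n m) ≃ₐ[ℂ] RingQuot (chRel n m) :=
  AlgEquiv.ofAlgHom (phi hm) (psi hm)
    (by
      apply RingQuot.ringQuot_ext'
      apply FreeAlgebra.hom_ext
      funext x
      cases x with
      | h i =>
        have h0 : FreeAlgebra.ι ℂ (ChGen.h i) = hG (n + m) i.1 := by simp [hG, i.2]
        have h1 := phi_hA hm i.1 i.2.1 i.2.2
        rw [← psi_h hm i.1 i.2] at h1
        simp only [Function.comp_apply, h0]
        exact h1
      | e i =>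
        have h0 : FreeAlgebra.ι ℂ (ChGen.e i) = eG (n + m) i.1 := by simp [eG, i.2]
        have h1 := phi_eA hm i.1 i.2.1 i.2.2
        rw [← psi_e hm i.1 i.2] at h1
        simp only [Function.comp_apply, h0]
        exact h1
      | f i =>
        have h0 : FreeAlgebra.ι ℂ (ChGen.f i) = fG (n + m) i.1 := by simp [fG, i.2]
        have h1 := phi_fA hm i.1 i.2.1 i.2.2
        rw [← psi_f hm i.1 i.2] at h1
        simp only [Function.comp_apply, h0]
        exact h1)
    (by
      apply RingQuot.ringQuot_ext'
      apply FreeAlgebra.hom_ext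
      funext x
      cases x with
      | plus i =>
        have h0 : FreeAlgebra.ι ℂ (AGen.plus i) = aPG (n + m) i.1 := by simp [aPG, i.2]
        have h1 := psi_a hm i.1 i.2.1 i.2.2
        rw [← phi_P hm i.1 i.2] at h1
        simp only [Function.comp_apply, h0]
        exact h1
      | minus i =>
        have h0 : FreeAlgebra.ι ℂ (AGen.minus i) = aMG (n + m) i.1 := by simp [aMG, i.2]
        have h1 := psi_b hm i.1 i.2.1 i.2.2
        rw [← phi_M hm i.1 i.2] at h1
        simp only [Function.comp_apply, h0]
        exact h1)

theorem phiEquiv_apply (x : RingQuot (aRel n m)) : phiEquiv hm x = phi hm x := rfl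

end Assembly

end SlPres

/-- Proposition 1: there is a `ℂ`-algebra isomorphism `φ : F_a ≃ F_Ch` determined
by `φ(a_1^-) = e_1`, `φ(a_1^+) = f_1` and, for `2 ≤ i ≤ N`,
`φ(a_i^-) = [φ(a_{i−1}^-), e_i]` and `φ(a_i^+) = [f_i, φ(a_{i−1}^+)]`. -/
theorem stmt2 (n m : ℕ) (hm : 1 ≤ m) :
    ∃ φ : RingQuot (aRel n m) ≃ₐ[ℂ] RingQuot (chRel n m),
      φ (aMQ n m 1) = eQ n m 1 ∧ φ (aPQ n m 1) = fQ n m 1 ∧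
      ∀ i : ℕ, 2 ≤ i → i ≤ n + m →
        φ (aMQ n m i) = φ (aMQ n m (i - 1)) * eQ n m i - eQ n m i * φ (aMQ n m (i - 1)) ∧
        φ (aPQ n m i) = fQ n m i * φ (aPQ n m (i - 1)) - φ (aPQ n m (i - 1)) * fQ n m i := by
  refine ⟨SlPres.phiEquiv hm, ?_, ?_, ?_⟩
  · rw [SlPres.phiEquiv_apply, SlPres.phi_M hm 1 ⟨le_refl 1, by omega⟩, SlPres.bC]
  · rw [SlPres.phiEquiv_apply, SlPres.phi_P hm 1 ⟨le_refl 1, by omega⟩, SlPres.aC]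
  · intro i hi hi'
    obtain ⟨k, rfl⟩ := Nat.exists_eq_add_of_le' hi
    have hk : k + 2 - 1 = k + 1 := rfl
    rw [hk]
    simp only [SlPres.phiEquiv_apply]
    rw [SlPres.phi_M hm (k + 2) ⟨by omega, hi'⟩, SlPres.phi_P hm (k + 2) ⟨by omega, hi'⟩,
      SlPres.phi_M hm (k + 1) ⟨by omega, by omega⟩, SlPres.phi_P hm (k + 1) ⟨by omega, by omega⟩,
      SlPres.bC, SlPres.aC]
    exact ⟨rfl, rfl⟩
end

section
/- The short list of relations (18) implies the full list of triple relations (17): under the stated assumptions, ⟦a_i^ξ, a_j^ξ⟧ = 0 for ALL i, j ∈ {1,…,N} and ξ = ±, and for ALL i, j, k ∈ {1,…,N} one has ⟦⟦a_i^+,a_j^-⟧,a_k^+⟧ = δ_{jk}a_i^+ + (−1)^{θ_i}δ_{ij}a_k^+ and ⟦⟦a_i^+,a_j^-⟧,a_k^-⟧ = −(−1)^{(θ_i+θ_j)θ_k}δ_{ik}a_j^- − (−1)^{θ_i}δ_{ij}a_k^- (i.e. the restriction |i−j| ≤ 1 can be removed). -/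
/-- Formal super-bracket of elements of formal degrees `d`, `e`. -/
def sbr {A : Type*} [Ring A] [Algebra ℂ A] (d e : ℕ) (x y : A) : A :=
  x * y - ((-1 : ℂ) ^ (d * e)) • (y * x)

section sbr
variable {A : Type*} [Ring A] [Algebra ℂ A]

lemma sbr_smul (d e : ℕ) (c : ℂ) (x y : A) : sbr d e x (c • y) = c • sbr d e x y := by
  simp only [sbr, mul_smul_comm, smul_mul_assoc, smul_sub, smul_comm c]

lemma sbr_zero (d e : ℕ) (x : A) : sbr d e x 0 = 0 := by simp [sbr]

lemma zero_sbr (d e : ℕ) (x : A) : sbr d e 0 x = 0 := by simp [sbr]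

lemma sgn_cases (d : ℕ) : (-1 : ℂ) ^ d = 1 ∨ (-1 : ℂ) ^ d = -1 := neg_one_pow_eq_or ℂ d

/-- Super Jacobi identity (derivation form). -/
lemma sbr_jacobi (d e f : ℕ) (x y z : A) :
    sbr d (e + f) x (sbr e f y z) =
      sbr (d + e) f (sbr d e x y) z + ((-1 : ℂ) ^ (d * e)) • sbr e (d + f) y (sbr d f x z) := by
  simp only [sbr, mul_add, add_mul, pow_add, mul_comm e d]
  rcases sgn_cases (d * e) with h1 | h1 <;> rcases sgn_cases (d * f) with h2 | h2 <;>
  rcases sgn_cases (e * f) with h3 | h3 <;> rw [h1, h2, h3] <;>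
  simp only [one_smul, neg_smul, mul_one, mul_neg, neg_neg] <;> noncomm_ring

lemma sbr_two (d p e f : ℕ) (x y : A) :
    sbr ((d + p) + (p + e)) f x y = sbr (d + e) f x y := by
  have : (-1 : ℂ) ^ (((d + p) + (p + e)) * f) = (-1 : ℂ) ^ ((d + e) * f) := by
    rw [show ((d + p) + (p + e)) * f = (d + e) * f + 2 * (p * f) by ring, pow_add, pow_mul]
    simp
  simp only [sbr, this]

lemma sbr_symm (d e : ℕ) (x y : A) (h : sbr d e x y = 0) : sbr e d y x = 0 := by
  simp only [sbr, mul_comm e d] at *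
  rcases sgn_cases (d * e) with h1 | h1 <;> rw [h1] at h ⊢ <;>
  simp only [one_smul, neg_smul, sub_neg_eq_add] at *
  · rw [← neg_sub, h, neg_zero]
  · rw [add_comm, h]

/-- the relations (17b), (17c) for fixed i j -/
def TripleRel (t : ℕ → ℕ) (N : ℕ) (aP aM : ℕ → A) (i j : ℕ) : Prop :=
  ∀ k, 1 ≤ k → k ≤ N →
    sbr (t i + t j) (t k) (sbr (t i) (t j) (aP i) (aM j)) (aP k)
      = (if j = k then (1 : ℂ) else 0) • aP i
        + (((-1 : ℂ) ^ t i) * (if i = j then 1 else 0)) • aP k ∧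
    sbr (t i + t j) (t k) (sbr (t i) (t j) (aP i) (aM j)) (aM k)
      = -((((-1 : ℂ) ^ ((t i + t j) * t k)) * (if i = k then 1 else 0)) • aM j)
        - (((-1 : ℂ) ^ t i) * (if i = j then 1 else 0)) • aM k

lemma rel_ne {t : ℕ → ℕ} {N : ℕ} {aP aM : ℕ → A} {i j : ℕ} (hij : i ≠ j)
    (h : TripleRel t N aP aM i j) (k : ℕ) (h1 : 1 ≤ k) (h2 : k ≤ N) :
    sbr (t i + t j) (t k) (sbr (t i) (t j) (aP i) (aM j)) (aP k)
      = (if j = k then (1 : ℂ) else 0) • aP i ∧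
    sbr (t i + t j) (t k) (sbr (t i) (t j) (aP i) (aM j)) (aM k)
      = (-((-1 : ℂ) ^ ((t i + t j) * t k)) * (if i = k then 1 else 0)) • aM j := by
  have := h k h1 h2
  by_cases hik : i = k
  · subst hik; simpa [hij] using this
  · simpa [hij, hik] using this

lemma sign_aux (a p b : ℕ) :
    (-1 : ℂ) ^ ((a + p) * (p + b)) * ((-1) ^ ((a + p) * a) * (-1) ^ ((p + b) * p))
      = (-1) ^ ((a + b) * a) := by
  simp only [add_mul, mul_add, pow_add, mul_comm p a, mul_comm b a, mul_comm b p]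
  rcases sgn_cases (a * p) with h1 | h1 <;> rcases sgn_cases (a * b) with h2 | h2 <;>
  rcases sgn_cases (p * b) with h3 | h3 <;> rcases sgn_cases (p * p) with h4 | h4 <;>
  rw [h1, h2, h3, h4] <;> ring

lemma rel_step {t : ℕ → ℕ} {N : ℕ} {aP aM : ℕ → A} {i p j : ℕ} (hij : i ≠ j) (hip : i ≠ p)
    (hpj : p ≠ j) (hi : 1 ≤ i) (hi' : i ≤ N) (hp : 1 ≤ p) (hp' : p ≤ N) (hj : 1 ≤ j) (hj' : j ≤ N)
    (h1 : TripleRel t N aP aM i p) (h2 : TripleRel t N aP aM p j) : TripleRel t N aP aM i j := by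
  have g1 := rel_ne hip h1
  have g2 := rel_ne hpj h2
  have key : sbr (t i + t p) (t p + t j) (sbr (t i) (t p) (aP i) (aM p))
      (sbr (t p) (t j) (aP p) (aM j)) = sbr (t i) (t j) (aP i) (aM j) := by
    rw [sbr_jacobi, (g1 p hp hp').1, (g1 j hj hj').2]
    have := sbr_two (t i) (t p) 0 (t j) (aP i) (aM j)
    simp only [add_zero] at this
    simp [hij, sbr_zero, add_assoc] at this ⊢
    exact this
  intro k hk hk'
  have act : ∀ x : A, sbr (t i + t j) (t k) (sbr (t i) (t j) (aP i) (aM j)) x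
      = sbr (t i + t p) ((t p + t j) + t k) (sbr (t i) (t p) (aP i) (aM p))
          (sbr (t p + t j) (t k) (sbr (t p) (t j) (aP p) (aM j)) x)
        - ((-1 : ℂ) ^ ((t i + t p) * (t p + t j))) •
          sbr (t p + t j) ((t i + t p) + t k) (sbr (t p) (t j) (aP p) (aM j))
            (sbr (t i + t p) (t k) (sbr (t i) (t p) (aP i) (aM p)) x) := by
    intro x
    rw [sbr_jacobi (t i + t p) (t p + t j) (t k), key, sbr_two]
    abel
  have c1 : ∀ x y : A, sbr (t i + t p) ((t p + t j) + t j) x y = sbr (t i + t p) (t p) x y := by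
    intro x y
    have : (-1 : ℂ) ^ ((t i + t p) * ((t p + t j) + t j)) = (-1 : ℂ) ^ ((t i + t p) * t p) := by
      rw [show (t i + t p) * ((t p + t j) + t j) = (t i + t p) * t p + 2 * ((t i + t p) * t j) by ring,
        pow_add, pow_mul (-1 : ℂ) 2]; simp
    simp only [sbr, this]
  have c2 : ∀ x y : A, sbr (t p + t j) ((t i + t p) + t p) x y = sbr (t p + t j) (t i) x y := by
    intro x y
    have : (-1 : ℂ) ^ ((t p + t j) * ((t i + t p) + t p)) = (-1 : ℂ) ^ ((t p + t j) * t i) := by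
      rw [show (t p + t j) * ((t i + t p) + t p) = (t p + t j) * t i + 2 * ((t p + t j) * t p) by ring,
        pow_add, pow_mul (-1 : ℂ) 2]; simp
    simp only [sbr, this]
  have c3 : ∀ x y : A, sbr (t i + t p) ((t p + t j) + t p) x y = sbr (t i + t p) (t j) x y := by
    intro x y
    have : (-1 : ℂ) ^ ((t i + t p) * ((t p + t j) + t p)) = (-1 : ℂ) ^ ((t i + t p) * t j) := by
      rw [show (t i + t p) * ((t p + t j) + t p) = (t i + t p) * t j + 2 * ((t i + t p) * t p) by ring,
        pow_add, pow_mul (-1 : ℂ) 2]; simp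
    simp only [sbr, this]
  have c4 : ∀ x y : A, sbr (t p + t j) ((t i + t p) + t i) x y = sbr (t p + t j) (t p) x y := by
    intro x y
    have : (-1 : ℂ) ^ ((t p + t j) * ((t i + t p) + t i)) = (-1 : ℂ) ^ ((t p + t j) * t p) := by
      rw [show (t p + t j) * ((t i + t p) + t i) = (t p + t j) * t p + 2 * ((t p + t j) * t i) by ring,
        pow_add, pow_mul (-1 : ℂ) 2]; simp
    simp only [sbr, this]
  constructor
  · rw [act, (g1 k hk hk').1, (g2 k hk hk').1, sbr_smul, sbr_smul]
    by_cases hjk : j = k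
    · subst hjk
      rw [c1, (g1 p hp hp').1]
      simp [hpj, hij]
    · by_cases hpk : p = k
      · subst hpk
        rw [c2, (g2 i hi hi').1]
        simp [hij, hij.symm, hjk]
      · simp [hij, hjk, hpk]
  · rw [act, (g1 k hk hk').2, (g2 k hk hk').2, sbr_smul, sbr_smul]
    by_cases hik : i = k
    · subst hik
      rw [c4, (g2 p hp hp').2]
      have := sign_aux (t i) (t p) (t j)
      simp only [hij, hip.symm, if_true, if_false, mul_one, mul_zero, zero_smul, sub_zero, zero_sub,
        smul_smul, ← this]
      congr 2
      ring
    · by_cases hpk : p = k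
      · subst hpk
        rw [c3, (g1 j hj hj').2]
        simp [hij, hik]
      · simp [hij, hik, hpk]

lemma rel_all {t : ℕ → ℕ} {N : ℕ} {aP aM : ℕ → A}
    (h : ∀ i j, 1 ≤ i → i ≤ N → 1 ≤ j → j ≤ N → i ≤ j + 1 → j ≤ i + 1 → TripleRel t N aP aM i j)
    (d : ℕ) : ∀ i j, 1 ≤ i → i ≤ N → 1 ≤ j → j ≤ N → i ≤ j + d → j ≤ i + d →
      TripleRel t N aP aM i j := by
  induction d with
  | zero => intro i j h1 h2 h3 h4 h5 h6; exact h i j h1 h2 h3 h4 (by omega) (by omega)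
  | succ d ih =>
    intro i j h1 h2 h3 h4 h5 h6
    by_cases hs : i ≤ j + 1 ∧ j ≤ i + 1
    · exact h i j h1 h2 h3 h4 hs.1 hs.2
    · rcases lt_or_ge i j with hlt | hge
      · exact rel_step (p := i + 1) (by omega) (by omega) (by omega) h1 h2 (by omega) (by omega) h3 h4
          (h _ _ h1 h2 (by omega) (by omega) (by omega) (by omega))
          (ih _ _ (by omega) (by omega) h3 h4 (by omega) (by omega))
      · exact rel_step (p := i - 1) (by omega) (by omega) (by omega) h1 h2 (by omega) (by omega) h3 h4
          (h _ _ h1 h2 (by omega) (by omega) (by omega) (by omega))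
          (ih _ _ (by omega) (by omega) h3 h4 (by omega) (by omega))

/-- Replace, in a vanishing bracket of creation generators, the first index. -/
lemma moveP {t : ℕ → ℕ} {N : ℕ} {aP aM : ℕ → A} {i k l : ℕ} (hil : i ≠ l) (hkl : k ≠ l)
    (hl : 1 ≤ l) (hl' : l ≤ N) (hk : 1 ≤ k) (hk' : k ≤ N)
    (h : TripleRel t N aP aM i l) (h0 : sbr (t l) (t k) (aP l) (aP k) = 0) :
    sbr (t i) (t k) (aP i) (aP k) = 0 := by
  have g := rel_ne hil h
  have J := sbr_jacobi (t i + t l) (t l) (t k) (sbr (t i) (t l) (aP i) (aM l)) (aP l) (aP k)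
  rw [h0, sbr_zero, (g l hl hl').1, (g k hk hk').1] at J
  have := sbr_two (t i) (t l) 0 (t k) (aP i) (aP k)
  simp only [add_zero] at this
  simp [hkl.symm, sbr_zero] at J
  rw [← this]
  exact J.symm

lemma moveM {t : ℕ → ℕ} {N : ℕ} {aP aM : ℕ → A} {i k l : ℕ} (hil : i ≠ l) (hkl : k ≠ l)
    (hl : 1 ≤ l) (hl' : l ≤ N) (hk : 1 ≤ k) (hk' : k ≤ N)
    (h : TripleRel t N aP aM l i) (h0 : sbr (t l) (t k) (aM l) (aM k) = 0) :
    sbr (t i) (t k) (aM i) (aM k) = 0 := by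
  have g := rel_ne hil.symm h
  have J := sbr_jacobi (t l + t i) (t l) (t k) (sbr (t l) (t i) (aP l) (aM i)) (aM l) (aM k)
  have e : sbr (t l + t i + t l) (t k) (aM i) (aM k) = sbr (t i) (t k) (aM i) (aM k) := by
    have := sbr_two (t i) (t l) 0 (t k) (aM i) (aM k)
    simp only [add_zero] at this
    rw [← this]; congr 1; ring
  rw [h0, sbr_zero, (g l hl hl').2, (g k hk hk').2] at J
  simp only [hkl.symm, if_true, if_false, mul_one, mul_zero, zero_smul, sbr_zero, smul_zero,
    add_zero] at J
  have e2 : ∀ c : ℂ, sbr (t l + t i + t l) (t k) (c • aM i) (aM k)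
      = c • sbr (t l + t i + t l) (t k) (aM i) (aM k) := by
    intro c
    simp only [sbr, mul_smul_comm, smul_mul_assoc, smul_sub, smul_comm c]
  rw [e2, e] at J
  rcases smul_eq_zero.1 J.symm with h | h
  · simp at h
  · exact h

lemma all_zero {t : ℕ → ℕ} {N : ℕ} {b : ℕ → A}
    (move : ∀ i k l, 1 ≤ i → i ≤ N → 1 ≤ k → k ≤ N → 1 ≤ l → l ≤ N → i ≠ l → k ≠ l →
      sbr (t l) (t k) (b l) (b k) = 0 → sbr (t i) (t k) (b i) (b k) = 0)
    (h1 : sbr (t 1) (t 1) (b 1) (b 1) = 0)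
    (h2 : 2 ≤ N → sbr (t 1) (t 2) (b 1) (b 2) = 0)
    (i j : ℕ) (hi : 1 ≤ i) (hi' : i ≤ N) (hj : 1 ≤ j) (hj' : j ≤ N) :
    sbr (t i) (t j) (b i) (b j) = 0 := by
  have first : ∀ k, 1 ≤ k → k ≤ N → sbr (t 1) (t k) (b 1) (b k) = 0 := by
    intro k hk hk'
    by_cases k1 : k = 1
    · subst k1; exact h1
    by_cases k2 : k = 2
    · subst k2; exact h2 hk'
    have hN : 2 ≤ N := by omega
    exact sbr_symm _ _ _ _ (move k 1 2 hk hk' le_rfl (by omega) (by omega) hN k2 (by omega)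
      (sbr_symm _ _ _ _ (h2 hN)))
  by_cases i1 : i = 1
  · subst i1; exact first j hj hj'
  by_cases j1 : j = 1
  · subst j1; exact sbr_symm _ _ _ _ (first i hi hi')
  exact move i j 1 hi hi' hj hj' le_rfl (by omega) i1 j1 (first j hj hj')

end sbr


/-- The short list of relations (18) implies the full list of triple
relations (17): the restriction `|i−j| ≤ 1` can be removed. -/
theorem stmt3 {A : Type*} [Ring A] [Algebra ℂ A]
    (n m : ℕ) (hm : 1 ≤ m)
    (aP aM : ℕ → A)
    -- (18a), first part: ⟦a_1^ξ, a_2^ξ⟧ = 0 (when N ≥ 2), for ξ = ±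
    (h18a2 : 2 ≤ n + m →
      aP 1 * aP 2 - ((-1 : ℂ) ^ (thetaIdx n 1 * thetaIdx n 2)) • (aP 2 * aP 1) = 0 ∧
      aM 1 * aM 2 - ((-1 : ℂ) ^ (thetaIdx n 1 * thetaIdx n 2)) • (aM 2 * aM 1) = 0)
    -- (18a), second part: ⟦a_1^ξ, a_1^ξ⟧ = 0, for ξ = ±
    (h18a1 : aP 1 * aP 1 - ((-1 : ℂ) ^ (thetaIdx n 1 * thetaIdx n 1)) • (aP 1 * aP 1) = 0 ∧
             aM 1 * aM 1 - ((-1 : ℂ) ^ (thetaIdx n 1 * thetaIdx n 1)) • (aM 1 * aM 1) = 0)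
    -- (18b): for |i−j| ≤ 1
    (h18b : ∀ i j k : ℕ, 1 ≤ i → i ≤ n + m → 1 ≤ j → j ≤ n + m → 1 ≤ k → k ≤ n + m →
      i ≤ j + 1 → j ≤ i + 1 →
      (aP i * aM j - ((-1 : ℂ) ^ (thetaIdx n i * thetaIdx n j)) • (aM j * aP i)) * aP k
        - ((-1 : ℂ) ^ ((thetaIdx n i + thetaIdx n j) * thetaIdx n k)) •
            (aP k * (aP i * aM j - ((-1 : ℂ) ^ (thetaIdx n i * thetaIdx n j)) • (aM j * aP i)))
      = (if j = k then (1 : ℂ) else 0) • aP i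
        + (((-1 : ℂ) ^ thetaIdx n i) * (if i = j then 1 else 0)) • aP k)
    -- (18c): for |i−j| ≤ 1
    (h18c : ∀ i j k : ℕ, 1 ≤ i → i ≤ n + m → 1 ≤ j → j ≤ n + m → 1 ≤ k → k ≤ n + m →
      i ≤ j + 1 → j ≤ i + 1 →
      (aP i * aM j - ((-1 : ℂ) ^ (thetaIdx n i * thetaIdx n j)) • (aM j * aP i)) * aM k
        - ((-1 : ℂ) ^ ((thetaIdx n i + thetaIdx n j) * thetaIdx n k)) •
            (aM k * (aP i * aM j - ((-1 : ℂ) ^ (thetaIdx n i * thetaIdx n j)) • (aM j * aP i)))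
      = -((((-1 : ℂ) ^ ((thetaIdx n i + thetaIdx n j) * thetaIdx n k))
            * (if i = k then 1 else 0)) • aM j)
        - (((-1 : ℂ) ^ thetaIdx n i) * (if i = j then 1 else 0)) • aM k) :
    -- (17a) for ALL i, j and ξ = ±
    (∀ i j : ℕ, 1 ≤ i → i ≤ n + m → 1 ≤ j → j ≤ n + m →
      aP i * aP j - ((-1 : ℂ) ^ (thetaIdx n i * thetaIdx n j)) • (aP j * aP i) = 0 ∧
      aM i * aM j - ((-1 : ℂ) ^ (thetaIdx n i * thetaIdx n j)) • (aM j * aM i) = 0) ∧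
    -- (17b) and (17c) for ALL i, j, k
    (∀ i j k : ℕ, 1 ≤ i → i ≤ n + m → 1 ≤ j → j ≤ n + m → 1 ≤ k → k ≤ n + m →
      ((aP i * aM j - ((-1 : ℂ) ^ (thetaIdx n i * thetaIdx n j)) • (aM j * aP i)) * aP k
        - ((-1 : ℂ) ^ ((thetaIdx n i + thetaIdx n j) * thetaIdx n k)) •
            (aP k * (aP i * aM j - ((-1 : ℂ) ^ (thetaIdx n i * thetaIdx n j)) • (aM j * aP i)))
      = (if j = k then (1 : ℂ) else 0) • aP i
        + (((-1 : ℂ) ^ thetaIdx n i) * (if i = j then 1 else 0)) • aP k) ∧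
      ((aP i * aM j - ((-1 : ℂ) ^ (thetaIdx n i * thetaIdx n j)) • (aM j * aP i)) * aM k
        - ((-1 : ℂ) ^ ((thetaIdx n i + thetaIdx n j) * thetaIdx n k)) •
            (aM k * (aP i * aM j - ((-1 : ℂ) ^ (thetaIdx n i * thetaIdx n j)) • (aM j * aP i)))
      = -((((-1 : ℂ) ^ ((thetaIdx n i + thetaIdx n j) * thetaIdx n k))
            * (if i = k then 1 else 0)) • aM j)
        - (((-1 : ℂ) ^ thetaIdx n i) * (if i = j then 1 else 0)) • aM k)) := by
  have R : ∀ i j, 1 ≤ i → i ≤ n + m → 1 ≤ j → j ≤ n + m →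
      TripleRel (thetaIdx n) (n + m) aP aM i j := by
    intro i j h1 h2 h3 h4
    refine rel_all ?_ (n + m) i j h1 h2 h3 h4 (by omega) (by omega)
    intro i j h1 h2 h3 h4 h5 h6 k h7 h8
    exact ⟨h18b i j k h1 h2 h3 h4 h7 h8 h5 h6, h18c i j k h1 h2 h3 h4 h7 h8 h5 h6⟩
  refine ⟨fun i j h1 h2 h3 h4 => ⟨?_, ?_⟩, fun i j k h1 h2 h3 h4 h5 h6 => R i j h1 h2 h3 h4 k h5 h6⟩
  · exact all_zero (t := thetaIdx n) (b := aP)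
      (fun i k l a b c d e f g h => moveP g h e f c d (R i l a b e f))
      h18a1.1 (fun h => (h18a2 h).1) i j h1 h2 h3 h4
  · exact all_zero (t := thetaIdx n) (b := aM)
      (fun i k l a b c d e f g h => moveM g h e f c d (R l i e f a b))
      h18a1.2 (fun h => (h18a2 h).2) i j h1 h2 h3 h4
end

section
/- (Identity (29).) If ab = (−1)^{αβ}ba, then for all p, q ∈ R: (ac − (−1)^{αγ}q·ca)·b − (−1)^{(α+γ)β}p·b·(ac − (−1)^{αγ}q·ca) = a·(cb − (−1)^{γβ}p·bc) − (−1)^{α(γ+β)}q·(cb − (−1)^{γβ}p·bc)·a. -/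
/-- `(-1)^k` for an integer exponent `k`, computed in the commutative ring `R`
(via the unit `-1`). -/
noncomputable def neg1pow (R : Type*) [CommRing R] (k : ℤ) : R :=
  (((-1 : Rˣ) ^ k : Rˣ) : R)

/-- Identity (29): if `ab = (−1)^{αβ} ba`, then for all `p, q ∈ R`,
`[[a,c]_q, b]_p = [a, [c,b]_p]_q`, written out with explicit signs coming from
the parities `α, β, γ` of `a, b, c`. -/
theorem stmt4 {R A : Type*} [CommRing R] [Ring A] [Algebra R A]
    (a b c : A) (α β γ : ℤ) (p q : R)
    (hab : a * b = neg1pow R (α * β) • (b * a)) :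
    (a * c - (neg1pow R (α * γ) * q) • (c * a)) * b
      - (neg1pow R ((α + γ) * β) * p) • (b * (a * c - (neg1pow R (α * γ) * q) • (c * a)))
    = a * (c * b - (neg1pow R (γ * β) * p) • (b * c))
      - (neg1pow R (α * (γ + β)) * q) • ((c * b - (neg1pow R (γ * β) * p) • (b * c)) * a) := by
  have hadd : ∀ m n : ℤ, neg1pow R (m + n) = neg1pow R m * neg1pow R n := by
    intro m n
    simp only [neg1pow, zpow_add, Units.val_mul]
  have h1 : c * a * b = neg1pow R (α * β) • (c * b * a) := by
    rw [mul_assoc, hab, mul_smul_comm, mul_assoc]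
  have h2 : a * (b * c) = neg1pow R (α * β) • (b * (a * c)) := by
    rw [← mul_assoc, hab, smul_mul_assoc, mul_assoc]
  rw [add_mul, mul_add, hadd, hadd]
  simp only [sub_mul, mul_sub, smul_mul_assoc, mul_smul_comm, h1, h2, smul_sub, smul_smul]
  simp only [mul_assoc]
  module
end

section
/- (Identity (30).) If ab = (−1)^{αβ}ba, then for all p, q ∈ R: a·(bc − (−1)^{βγ}q·cb) − (−1)^{α(β+γ)}p·(bc − (−1)^{βγ}q·cb)·a = (−1)^{αβ}·[b·(ac − (−1)^{αγ}p·ca) − (−1)^{β(α+γ)}q·(ac − (−1)^{αγ}p·ca)·b]. -/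
/-- Identity (30): if `ab = (−1)^{αβ} ba`, then for all `p, q ∈ R`,
`[a, [b,c]_q]_p = (−1)^{αβ} [b, [a,c]_p]_q`, written out with explicit signs
coming from the parities `α, β, γ` of `a, b, c`. -/
theorem stmt5 {R A : Type*} [CommRing R] [Ring A] [Algebra R A]
    (a b c : A) (α β γ : ℤ) (p q : R)
    (hab : a * b = neg1pow R (α * β) • (b * a)) :
    a * (b * c - (neg1pow R (β * γ) * q) • (c * b))
      - (neg1pow R (α * (β + γ)) * p) • ((b * c - (neg1pow R (β * γ) * q) • (c * b)) * a)
    = neg1pow R (α * β) •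
        (b * (a * c - (neg1pow R (α * γ) * p) • (c * a))
          - (neg1pow R (β * (α + γ)) * q) • ((a * c - (neg1pow R (α * γ) * p) • (c * a)) * b)) := by
  have hadd : ∀ m n : ℤ, neg1pow R (m + n) = neg1pow R m * neg1pow R n := by
    intro m n
    simp [neg1pow, zpow_add]
  have hsq : ∀ m : ℤ, neg1pow R m * neg1pow R m = 1 := by
    intro m
    rw [neg1pow, ← Units.val_mul, ← mul_zpow]
    simp
  have h1 : a * (b * c) = neg1pow R (α * β) • (b * (a * c)) := by
    rw [← mul_assoc, hab, smul_mul_assoc, mul_assoc]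
  have h2 : c * (a * b) = neg1pow R (α * β) • (c * (b * a)) := by
    rw [hab, mul_smul_comm]
  have e := hsq (α * β)
  rw [mul_add α, mul_add β, hadd, hadd, mul_comm β α]
  generalize neg1pow R (α * β) = x at *
  generalize neg1pow R (α * γ) = y at *
  generalize neg1pow R (β * γ) = z at *
  simp only [mul_sub, sub_mul, smul_sub, mul_smul_comm, smul_mul_assoc, mul_assoc, h1, h2,
    smul_smul]
  have e1 : x * (x * (z * q)) = z * q := by rw [← mul_assoc, e, one_mul]
  have e2 : x * (x * (z * (q * (y * (p * x))))) = x * (y * (p * (z * q))) := by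
    rw [← mul_assoc, e]; ring
  rw [e1, e2]
  abel
end

section
/- (Identity (31), with b even.) If ac = (−1)^{αγ}ca, then (x + x̄)·(bT − Tb) = (aU − (−1)^{αγ}x²·Ua) − (Vc − (−1)^{αγ}x²·cV), where T := a·[b,c]_x − (−1)^{αγ}x·[b,c]_x·a, U := [b,[b,c]_x]_{x̄} and V := [b,[b,a]_x]_{x̄}. -/
/-- The `y`-deformed commutator `[u,v]_y = uv − y·vu`. -/
def cmx {R A : Type*} [CommRing R] [Ring A] [Algebra R A] (y : R) (u v : A) : A :=
  u * v - y • (v * u)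

/-- Identity (31), with `b` even: if `ac = (−1)^{αγ} ca` and `x` is invertible with
inverse `xb`, then `(x + x̄)(bT − Tb) = (aU − (−1)^{αγ}x²Ua) − (Vc − (−1)^{αγ}x²cV)`,
where `T = a[b,c]_x − (−1)^{αγ}x[b,c]_x a`, `U = [b,[b,c]_x]_{x̄}`, `V = [b,[b,a]_x]_{x̄}`. -/
theorem stmt6 {R A : Type*} [CommRing R] [Ring A] [Algebra R A]
    (a b c : A) (α γ : ℤ) (x xb : R) (hx : x * xb = 1)
    (hac : a * c = neg1pow R (α * γ) • (c * a)) :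
    let T : A := a * cmx x b c - (neg1pow R (α * γ) * x) • (cmx x b c * a)
    let U : A := cmx xb b (cmx x b c)
    let V : A := cmx xb b (cmx x b a)
    (x + xb) • (b * T - T * b)
      = (a * U - (neg1pow R (α * γ) * x ^ 2) • (U * a))
        - (V * c - (neg1pow R (α * γ) * x ^ 2) • (c * V)) := by
  intro T U V
  simp only [T, U, V, cmx]
  generalize neg1pow R (α * γ) = s at hac ⊢
  have h1 : b * (a * (c * b)) = s • (b * (c * (a * b))) := by
    rw [← mul_assoc a c b, hac]; simp [mul_assoc]
  have h2 : a * (c * (b * b)) = s • (c * (a * (b * b))) := by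
    rw [← mul_assoc a c, hac]; simp [mul_assoc]
  have h3 : b * (b * (a * c)) = s • (b * (b * (c * a))) := by
    rw [hac]; simp
  simp only [mul_sub, sub_mul, smul_mul_assoc, mul_smul_comm, mul_assoc, smul_sub, h1, h2, h3]
  linear_combination (norm := module) hx • (-(s • (b * (b * (c * a)))) + (s * x ^ 2) • (c * (b * (b * a)))
    + a * (b * (b * c)) - (s * x ^ 2) • (c * (a * (b * b))))
end

section
/- (Identity (32), with a even.) If bc = (−1)^{βγ}cb, then (x + x̄)·(aS − Sa) = (bU − (−1)^{βγ}x²·Ub) − (Vc − (−1)^{βγ}x²·cV), where S := [b,a]_x·c − (−1)^{βγ}x·c·[b,a]_x, U := [a,[a,c]_x]_{x̄} and V := [a,[a,b]_x]_{x̄}. -/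
/-- Identity (32), with `a` even: if `bc = (−1)^{βγ} cb` and `x` is invertible with
inverse `xb`, then `(x + x̄)(aS − Sa) = (bU − (−1)^{βγ}x²Ub) − (Vc − (−1)^{βγ}x²cV)`,
where `S = [b,a]_x c − (−1)^{βγ}x c [b,a]_x`, `U = [a,[a,c]_x]_{x̄}`, `V = [a,[a,b]_x]_{x̄}`. -/
theorem stmt7 {R A : Type*} [CommRing R] [Ring A] [Algebra R A]
    (a b c : A) (β γ : ℤ) (x xb : R) (hx : x * xb = 1)
    (hbc : b * c = neg1pow R (β * γ) • (c * b)) :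
    let S : A := cmx x b a * c - (neg1pow R (β * γ) * x) • (c * cmx x b a)
    let U : A := cmx xb a (cmx x a c)
    let V : A := cmx xb a (cmx x a b)
    (x + xb) • (a * S - S * a)
      = (b * U - (neg1pow R (β * γ) * x ^ 2) • (U * b))
        - (V * c - (neg1pow R (β * γ) * x ^ 2) • (c * V)) := by
  intro S U V
  have hU : ∀ z : A, cmx xb a (cmx x a z)
      = a * (a * z) - (x + xb) • (a * (z * a)) + z * (a * a) := by
    intro z
    have h : (x * xb) • (z * (a * a)) = z * (a * a) := by rw [hx, one_smul]
    rw [← h]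
    simp only [cmx, mul_sub, sub_mul, smul_mul_assoc, mul_smul_comm, mul_assoc]
    module
  have hbc' : ∀ z : A, b * (c * z) = neg1pow R (β * γ) • (c * (b * z)) := by
    intro z
    rw [← mul_assoc, hbc, smul_mul_assoc, mul_assoc]
  have hUe : U = _ := hU c
  have hVe : V = _ := hU b
  rw [hUe, hVe]
  simp only [S, cmx]
  generalize neg1pow R (β * γ) = s at *
  simp only [mul_sub, sub_mul, mul_add, add_mul, smul_mul_assoc, mul_smul_comm, mul_assoc, hbc, hbc']
  linear_combination (norm := module) hx • (s • (c * (b * (a * a)) - a * (a * (c * b))))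
end

section
/- (Identity (36).) For every x ∈ R: ⟦⟦a,b⟧_x, c⟧ = (−1)^{βγ}·⟦⟦a,c⟧,b⟧_x + ⟦a,⟦b,c⟧⟧_x, where ⟦a,b⟧_x := ab − (−1)^{αβ}x·ba, ⟦⟦a,b⟧_x,c⟧ := ⟦a,b⟧_x·c − (−1)^{(α+β)γ}·c·⟦a,b⟧_x, ⟦a,c⟧ := ac − (−1)^{αγ}ca, ⟦⟦a,c⟧,b⟧_x := ⟦a,c⟧·b − (−1)^{(α+γ)β}x·b·⟦a,c⟧, ⟦b,c⟧ := bc − (−1)^{βγ}cb and ⟦a,⟦b,c⟧⟧_x := a·⟦b,c⟧ − (−1)^{α(β+γ)}x·⟦b,c⟧·a. -/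
/-- Identity (36): for every `x ∈ R`,
`⟦⟦a,b⟧_x, c⟧ = (−1)^{βγ} ⟦⟦a,c⟧,b⟧_x + ⟦a,⟦b,c⟧⟧_x`, where all super-brackets
are written out explicitly with the signs determined by the parities `α, β, γ`. -/
theorem stmt8 {R A : Type*} [CommRing R] [Ring A] [Algebra R A]
    (a b c : A) (α β γ : ℤ) (x : R) :
    let ab : A := a * b - (neg1pow R (α * β) * x) • (b * a)        -- ⟦a,b⟧_x
    let ac : A := a * c - neg1pow R (α * γ) • (c * a)              -- ⟦a,c⟧
    let bc : A := b * c - neg1pow R (β * γ) • (c * b)              -- ⟦b,c⟧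
    ab * c - neg1pow R ((α + β) * γ) • (c * ab)
      = neg1pow R (β * γ) • (ac * b - (neg1pow R ((α + γ) * β) * x) • (b * ac))
        + (a * bc - (neg1pow R (α * (β + γ)) * x) • (bc * a)) := by
  intro ab ac bc
  have hadd : ∀ k l : ℤ, neg1pow R (k + l) = neg1pow R k * neg1pow R l := by
    intro k l
    simp [neg1pow, zpow_add]
  have hsq : neg1pow R (β * γ) * neg1pow R (β * γ) = 1 := by
    rw [← hadd, neg1pow, Even.neg_one_zpow ⟨β * γ, rfl⟩, Units.val_one]
  simp only [ab, ac, bc, add_mul, mul_add, hadd, mul_comm γ β]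
  generalize neg1pow R (α * β) = p
  generalize neg1pow R (α * γ) = q
  generalize neg1pow R (β * γ) = r at *
  simp only [mul_sub, sub_mul, smul_sub, mul_smul_comm, smul_mul_assoc, smul_smul, mul_assoc]
  match_scalars <;> first | ring1 | linear_combination (-p * x) * hsq | linear_combination (p * x) * hsq | linear_combination (p * q * x) * hsq | linear_combination (-p * q * x) * hsq
end

section
/- (Identity (42).) Let z, s, r ∈ R and set x = zs, y = zr, t = zsr. Then ⟦a,⟦b,c⟧_x⟧_y = ⟦⟦a,b⟧_z,c⟧_t + z·(−1)^{αβ}·⟦b,⟦a,c⟧_r⟧_s, where for u, v ∈ A of parities μ, ν and w ∈ R one writes ⟦u,v⟧_w := uv − (−1)^{μν}w·vu, the parity of a bracket being the sum of the parities of its arguments (so ⟦b,c⟧_x has parity β+γ, ⟦a,b⟧_z has parity α+β, ⟦a,c⟧_r has parity α+γ). -/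
theorem neg1pow_add_aux (R : Type*) [CommRing R] (k l : ℤ) :
    neg1pow R (k + l) = neg1pow R k * neg1pow R l := by
  simp [neg1pow, zpow_add]

theorem neg1pow_sq_aux (R : Type*) [CommRing R] (k : ℤ) :
    neg1pow R k * neg1pow R k = 1 := by
  rw [← neg1pow_add_aux, neg1pow, Even.neg_one_zpow ⟨k, rfl⟩, Units.val_one]

/-- Identity (42): for `z, s, r ∈ R`, with `x = zs`, `y = zr`, `t = zsr`,
`⟦a,⟦b,c⟧_x⟧_y = ⟦⟦a,b⟧_z,c⟧_t + z(−1)^{αβ}⟦b,⟦a,c⟧_r⟧_s`, where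
`⟦u,v⟧_w = uv − (−1)^{μν} w·vu` for `u, v` of parities `μ, ν`, the parity of a
bracket being the sum of the parities of its arguments. -/
theorem stmt9 {R A : Type*} [CommRing R] [Ring A] [Algebra R A]
    (a b c : A) (α β γ : ℤ) (z s r : R) :
    let x : R := z * s
    let y : R := z * r
    let t : R := z * s * r
    let bc : A := b * c - (neg1pow R (β * γ) * x) • (c * b)        -- ⟦b,c⟧_x
    let ab : A := a * b - (neg1pow R (α * β) * z) • (b * a)        -- ⟦a,b⟧_z
    let ac : A := a * c - (neg1pow R (α * γ) * r) • (c * a)        -- ⟦a,c⟧_r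
    a * bc - (neg1pow R (α * (β + γ)) * y) • (bc * a)
      = (ab * c - (neg1pow R ((α + β) * γ) * t) • (c * ab))
        + (z * neg1pow R (α * β)) • (b * ac - (neg1pow R (β * (α + γ)) * s) • (ac * b)) := by
  intro x y t bc ab ac
  have hp := neg1pow_sq_aux R (α * β)
  simp only [x, y, t, bc, ab, ac, mul_add, add_mul, neg1pow_add_aux, mul_comm β α]
  generalize neg1pow R (α * β) = p at *
  generalize neg1pow R (α * γ) = q
  generalize neg1pow R (β * γ) = w
  simp only [mul_sub, sub_mul, smul_sub, mul_smul_comm, smul_mul_assoc, smul_smul, mul_assoc]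
  have h1 : z * (p * (p * (w * s))) = w * (z * s) := by
    linear_combination (z * w * s) * hp
  have h2 : z * (p * (p * (w * (s * (q * r))))) = q * (w * (z * (s * r))) := by
    linear_combination (z * w * s * q * r) * hp
  rw [h1, h2]
  module
end

section
/- For all 1 ≤ i, j ≤ N one has the Cartan-matrix summation identity Σ_{p=1}^{i} Σ_{r=1}^{j} (−1)^{θ_{p−1}}·α_{pr} = 1 + (−1)^{θ_i}·δ_{ij}. -/
theorem row_term (n p r : ℕ) :
    (-1 : ℤ) ^ thetaIdx n (p - 1) * alphaMat n p r
      = ((-1) ^ thetaIdx n (p - 1) + (-1) ^ thetaIdx n p) * (if p = r then 1 else 0)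
        - (-1) ^ thetaIdx n p * (if p + 1 = r then 1 else 0)
        - (-1) ^ thetaIdx n (p - 1) * (if p = r + 1 then 1 else 0) := by
  have h : (-1 : ℤ) ^ thetaIdx n (p - 1) * (-1) ^ thetaIdx n (p - 1) = 1 := by
    rw [← mul_pow]; norm_num
  unfold alphaMat pIdx
  rw [pow_add]
  linear_combination ((-1 : ℤ) ^ thetaIdx n p * (if p = r then 1 else 0)
    - (-1) ^ thetaIdx n p * (if p + 1 = r then 1 else 0)) * h

theorem row_sum (n p j : ℕ) (hp : 1 ≤ p) :
    (∑ r ∈ Finset.Icc 1 j, (-1 : ℤ) ^ thetaIdx n (p - 1) * alphaMat n p r)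
      = ((-1) ^ thetaIdx n (p - 1) + (-1) ^ thetaIdx n p) * (if p ≤ j then 1 else 0)
        - (-1) ^ thetaIdx n p * (if p + 1 ≤ j then 1 else 0)
        - (-1) ^ thetaIdx n (p - 1) * (if 2 ≤ p ∧ p ≤ j + 1 then 1 else 0) := by
  induction j with
  | zero =>
    have h1 : ¬ p ≤ 0 := by omega
    have h2 : ¬ (2 ≤ p ∧ p ≤ 0 + 1) := by omega
    simp [h1]
    omega
  | succ j ih =>
    rw [Finset.sum_Icc_succ_top (by omega), ih, row_term]
    split_ifs <;> first | omega | ring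

/-- The Cartan-matrix summation identity
`Σ_{p=1}^{i} Σ_{r=1}^{j} (−1)^{θ_{p−1}} α_{pr} = 1 + (−1)^{θ_i} δ_{ij}`. -/
theorem stmt14 (n m : ℕ) (hm : 1 ≤ m) :
    ∀ i j : ℕ, 1 ≤ i → i ≤ n + m → 1 ≤ j → j ≤ n + m →
      (∑ p ∈ Finset.Icc 1 i, ∑ r ∈ Finset.Icc 1 j,
          (-1 : ℤ) ^ thetaIdx n (p - 1) * alphaMat n p r)
        = 1 + (-1 : ℤ) ^ thetaIdx n i * (if i = j then 1 else 0) := by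
  intro i j hi _ hj _
  induction i, hi using Nat.le_induction with
  | base =>
    have h0 : thetaIdx n 0 = 0 := by simp [thetaIdx]
    rw [Finset.Icc_self, Finset.sum_singleton, row_sum n 1 j le_rfl]
    simp only [Nat.sub_self, h0, pow_zero]
    split_ifs <;> first | omega | ring
  | succ i hi ih =>
    rw [Finset.sum_Icc_succ_top (by omega), ih (by omega), row_sum n (i + 1) j (by omega)]
    simp only [Nat.add_sub_cancel]
    split_ifs <;> first | omega | (subst_vars; ring)
end
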